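/- arXiv:2504.15750 — 2 statements merged into one kernel-verified Lean document; each statement's English description precedes it below -/
import Mathlib

section
/- Let Φ = {Φ_Λ}_{Λ∈𝒞} be a T-invariant interaction potential on X = S^ℤ with ∑_{Λ∋0} ‖Φ_Λ‖ < ∞. If ∑_{Λ∋0, Λ∩[n,∞)≠∅} var(Φ_Λ) ≤ 1/(2n) for all n ≥ 1, then Φ has a unique T-invariant Gibbs state. -/
open MeasureTheory Filter Set Asymptotics

noncomputable section

namespace GibbsFormal

/-- The configuration space `X = S^ℤ`. -/
abbrev Conf (S : Type) := ℤ → S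

variable {S : Type} [Fintype S] [Nonempty S] [DecidableEq S]
  [TopologicalSpace S] [DiscreteTopology S]
  [MeasurableSpace S] [MeasurableSingletonClass S]

/-- The configuration obtained from `x` by replacing its coordinates on `Λ` by `ζ`. -/
def ov (x : Conf S) (Λ : Finset ℤ) (ζ : Λ → S) : Conf S :=
  fun i => if h : i ∈ Λ then ζ ⟨i, h⟩ else x i

/-- The configuration `x'_Λ x_{Λᶜ}`, agreeing with `x'` on `Λ` and with `x` off `Λ`. -/
def merge (Λ : Finset ℤ) (x' x : Conf S) : Conf S :=
  fun i => if i ∈ Λ then x' i else x i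

/-- The configuration `s_n x`. -/
def upd (s : S) (n : ℤ) (x : Conf S) : Conf S :=
  fun i => if i = n then s else x i

/-- The shift `Tⁿ`:  `(Tⁿ x) i = x (i + n)`. -/
def shift (n : ℤ) (x : Conf S) : Conf S := fun i => x (i + n)

/-- The sub-σ-algebra `ℬ_Λ` of the Borel (= product) σ-algebra, generated by
coordinates in `Λ`. -/
def cylSA (Λ : Set ℤ) : MeasurableSpace (Conf S) :=
  MeasurableSpace.comap (fun x => Λ.restrict x) inferInstance

/-- The cylinder set `[ζ]_Λ`. -/
def cylEvent (Λ : Finset ℤ) (ζ : Λ → S) : Set (Conf S) :=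
  {y | ∀ i : Λ, y i = ζ i}

/-- `r_Λ(f) = sup {f x / f y : x_Λ = y_Λ}`. -/
def rSup (Λ : Set ℤ) (f : Conf S → ℝ) : ℝ :=
  sSup {r : ℝ | ∃ x y : Conf S, (∀ i ∈ Λ, x i = y i) ∧ f x / f y = r}

/-- `r̄_Λ(f) = inf {f x / f y : x_Λ = y_Λ}`. -/
def rInf (Λ : Set ℤ) (f : Conf S → ℝ) : ℝ :=
  sInf {r : ℝ | ∃ x y : Conf S, (∀ i ∈ Λ, x i = y i) ∧ f x / f y = r}

/-- A specification `𝒱 = {φ_Λ}` on `S^ℤ`:  a family of nonnegative Borel functions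
satisfying the normalisation and consistency conditions.  (The value on the empty set
is normalised to `1`, which is forced by the unguarded normalisation condition.) -/
structure Specification (A : Type) [Fintype A] [MeasurableSpace A] where
  φ : Finset ℤ → Conf A → ℝ
  nonneg : ∀ Λ x, 0 ≤ φ Λ x
  measurable : ∀ Λ, Measurable (φ Λ)
  sum_one : ∀ (Λ : Finset ℤ) (x : Conf A), ∑ ζ : Λ → A, φ Λ (ov x Λ ζ) = 1
  consistent : ∀ (K Λ : Finset ℤ), K ⊆ Λ → ∀ x : Conf A,
    φ Λ x = φ K x * ∑ ζ : K → A, φ Λ (ov x K ζ)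

/-- A positive specification. -/
def Specification.Positive (V : Specification S) : Prop := ∀ Λ x, 0 < V.φ Λ x

/-- A continuous specification. -/
def Specification.IsCont (V : Specification S) : Prop := ∀ Λ, Continuous (V.φ Λ)

/-- A `T`-invariant specification: `φ_{n+Λ}(x) = φ_Λ(Tⁿ x)`. -/
def Specification.TInvariant (V : Specification S) : Prop :=
  ∀ (n : ℤ) (Λ : Finset ℤ) (x : Conf S),
    V.φ (Λ.image fun i => n + i) x = V.φ Λ (shift n x)

/-- The DLR (Gibbs) condition for a family `φfam` of conditional probabilities:
for each finite nonempty `Λ` and each pattern `ζ` on `Λ`, the conditional probability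
of the cylinder `[ζ]_Λ` given `ℬ_{Λᶜ}` is `x ↦ φfam Λ (ζ x_{Λᶜ})`, `μ`-a.e. -/
def GibbsCond (φfam : Finset ℤ → Conf S → ℝ) (μ : Measure (Conf S)) : Prop :=
  ∀ (Λ : Finset ℤ), Λ.Nonempty → ∀ ζ : Λ → S,
    (fun x => φfam Λ (ov x Λ ζ)) =ᵐ[μ]
      μ[(cylEvent Λ ζ).indicator (fun _ => (1 : ℝ)) | cylSA ((↑Λ : Set ℤ)ᶜ)]

/-- `μ` is a Gibbs state for the specification `V`. -/
def IsGibbs (V : Specification S) (μ : Measure (Conf S)) : Prop :=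
  IsProbabilityMeasure μ ∧ GibbsCond V.φ μ

/-- `g ∈ 𝒢_X`: a nonnegative bounded `ℬ_{ℤ⁻}`-measurable function with
`∑_{s ∈ S} g (s_0 x) = 1`. -/
def MemG (g : Conf S → ℝ) : Prop :=
  (∃ C, ∀ x, |g x| ≤ C) ∧ (∀ x, 0 ≤ g x) ∧
    Measurable[cylSA (Set.Iic (0 : ℤ))] g ∧
    ∀ x : Conf S, ∑ s : S, g (upd s 0 x) = 1

/-- `μ` is a `g`-chain: for every `n` the conditional probability of the symbol at
site `n` given `ℬ_{(-∞,n-1]}` is `x ↦ g (Tⁿ (s_n x))`, `μ`-a.e. -/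
def IsGChain (g : Conf S → ℝ) (μ : Measure (Conf S)) : Prop :=
  IsProbabilityMeasure μ ∧ ∀ (n : ℤ) (s : S),
    (fun x => g (shift n (upd s n x))) =ᵐ[μ]
      μ[({y : Conf S | y n = s}).indicator (fun _ => (1 : ℝ)) | cylSA (Set.Iic (n - 1))]

/-- The probability `π^𝒱_{[0,n]}([x]_{{0}} | x)`. -/
def piG (V : Specification S) (n : ℕ) (x : Conf S) : ℝ :=
  ∑ ζ : (Finset.Icc (0 : ℤ) (n : ℤ)) → S,
    V.φ (Finset.Icc (0 : ℤ) (n : ℤ)) (ov x (Finset.Icc (0 : ℤ) (n : ℤ)) ζ) *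
      (if ov x (Finset.Icc (0 : ℤ) (n : ℤ)) ζ 0 = x 0 then 1 else 0)

/-- A specification sequence of the form `{([0,n], f_n)}`: each `f_n` is bounded,
strictly positive and `ℬ_{[0,n-1]ᶜ}`-measurable. -/
def IsSpecSeq (f : ℕ → Conf S → ℝ) : Prop :=
  ∀ n : ℕ, (∃ C, ∀ x, f n x ≤ C) ∧ (∀ x, 0 < f n x) ∧
    Measurable[cylSA ((Set.Ico (0 : ℤ) (n : ℤ))ᶜ)] (f n)

/-- `{([0,n], f_n)}` is a specification sequence for the family `φfam`. -/
def IsSpecSeqForFam (φfam : Finset ℤ → Conf S → ℝ) (f : ℕ → Conf S → ℝ) : Prop :=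
  IsSpecSeq f ∧ ∀ (n : ℕ) (x : Conf S),
    φfam (Finset.Icc (0 : ℤ) (n : ℤ)) x =
      (∏ j ∈ Finset.range (n + 1), f j x) /
        ∑ ζ : (Finset.Icc (0 : ℤ) (n : ℤ)) → S,
          ∏ j ∈ Finset.range (n + 1), f j (ov x (Finset.Icc (0 : ℤ) (n : ℤ)) ζ)

/-- `{([0,n], f_n)}` is a specification sequence for the specification `V`. -/
def IsSpecSeqFor (V : Specification S) (f : ℕ → Conf S → ℝ) : Prop :=
  IsSpecSeqForFam V.φ f

/-- The operator `L_{m,n} h (x) = ∑_{y ∈ [x]_{[m,n]ᶜ}} (∏_{i=m}^n f_i y) · h y`. -/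
def Lop (f : ℕ → Conf S → ℝ) (m n : ℕ) (h : Conf S → ℝ) (x : Conf S) : ℝ :=
  ∑ ζ : (Finset.Icc (m : ℤ) (n : ℤ)) → S,
    (∏ i ∈ Finset.Icc m n, f i (ov x (Finset.Icc (m : ℤ) (n : ℤ)) ζ)) *
      h (ov x (Finset.Icc (m : ℤ) (n : ℤ)) ζ)

/-- The ratio bounds `ρ_k^{(n)}(x,y)` (with `ρ_{-1}^{(n)}` for negative `k`). -/
def rho (f : ℕ → Conf S → ℝ) (k : ℤ) (n : ℕ) (x y : Conf S) : ℝ :=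
  if k < 0 then
    sInf {r : ℝ | ∃ m : ℕ,
      Lop f m (m + n) (fun _ => 1) x / Lop f m (m + n) (fun _ => 1) y = r}
  else
    sInf {r : ℝ | ∃ (m : ℕ) (ζ : (Finset.Icc (m : ℤ) ((m : ℤ) + k)) → S),
      Lop f m (m + n) ((cylEvent (Finset.Icc (m : ℤ) ((m : ℤ) + k)) ζ).indicator
          fun _ => 1) x /
        Lop f m (m + n) ((cylEvent (Finset.Icc (m : ℤ) ((m : ℤ) + k)) ζ).indicator
          fun _ => 1) y = r}

/-- A `T`-invariant interaction potential `Φ = {Φ_Λ}`. -/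
structure Potential (A : Type) [Fintype A] [MeasurableSpace A] where
  Φ : Finset ℤ → Conf A → ℝ
  measurable : ∀ Λ : Finset ℤ, Λ.Nonempty → Measurable[cylSA (↑Λ : Set ℤ)] (Φ Λ)
  bounded : ∀ Λ : Finset ℤ, ∃ C, ∀ x, |Φ Λ x| ≤ C
  invariant : ∀ (n : ℤ) (Λ : Finset ℤ), Λ.Nonempty → ∀ x : Conf A,
    Φ (Λ.image fun i => n + i) x = Φ Λ (shift n x)

/-- `var(h) = sup h − inf h`. -/
def pvar (h : Conf S → ℝ) : ℝ := (⨆ x, h x) - ⨅ x, h x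

/-- `‖h‖ = sup |h|`. -/
def pnorm (h : Conf S → ℝ) : ℝ := ⨆ x, |h x|

/-- `∑_{Λ ∋ 0} ‖Φ_Λ‖ < ∞`. -/
def NormSummable (P : Potential S) : Prop :=
  Summable fun Λ : {Λ : Finset ℤ // (0 : ℤ) ∈ Λ} => pnorm (P.Φ ↑Λ)

/-- `∑_{Λ ∋ 0, Λ ∩ [n,∞) ≠ ∅} var(Φ_Λ)`. -/
def varTail (P : Potential S) (n : ℕ) : ℝ :=
  ∑' Λ : {Λ : Finset ℤ // (0 : ℤ) ∈ Λ ∧ ∃ i ∈ Λ, (n : ℤ) ≤ i}, pvar (P.Φ ↑Λ)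

/-- The Hamiltonian `H_Λ(x) = ∑_{K ∩ Λ ≠ ∅} Φ_K(x)`. -/
def HPot (P : Potential S) (Λ : Finset ℤ) (x : Conf S) : ℝ :=
  ∑' K : {K : Finset ℤ // (K ∩ Λ).Nonempty}, P.Φ ↑K x

/-- The specification `𝒱_Φ` associated with an interaction potential. -/
def potPhi (P : Potential S) (Λ : Finset ℤ) (x : Conf S) : ℝ :=
  Real.exp (-HPot P Λ x) / ∑ ζ : Λ → S, Real.exp (-HPot P Λ (ov x Λ ζ))

/-- `μ` is a Gibbs state for the potential `P`. -/
def IsGibbsPot (P : Potential S) (μ : Measure (Conf S)) : Prop :=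
  IsProbabilityMeasure μ ∧ GibbsCond (potPhi P) μ

/-- `(T,μ)` is Bernoulli: the shift on `(S^ℤ, μ)` is measure-theoretically isomorphic
(mod 0) to the shift on `A^ℤ` carrying an i.i.d. product probability measure for some
finite alphabet `A` (wlog `A = Fin m`). -/
def IsBernoulliSystem (μ : Measure (Conf S)) : Prop :=
  ∃ (m : ℕ) (p : Fin m → ENNReal) (ν : Measure (ℤ → Fin m)),
    IsProbabilityMeasure ν ∧ (∑ a, p a = 1) ∧
    (∀ (Λ : Finset ℤ) (ζ : Λ → Fin m),
      ν {y : ℤ → Fin m | ∀ i : Λ, y ↑i = ζ i} = ∏ i : Λ, p (ζ i)) ∧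
    ∃ (θ : Conf S → ℤ → Fin m) (θinv : (ℤ → Fin m) → Conf S),
      Measurable θ ∧ Measurable θinv ∧ μ.map θ = ν ∧
      (∀ᵐ x ∂μ, θ (shift 1 x) = fun i => θ x (i + 1)) ∧
      (∀ᵐ x ∂μ, θinv (θ x) = x) ∧ (∀ᵐ y ∂ν, θ (θinv y) = y)

/-- The recursively defined quantities `p_k^{(n)}` of Lemma 3.3 (`k = -1` is encoded
by any negative argument). -/
def pSeq (v : ℕ → ℝ) : ℕ → ℤ → ℝ
  | 0, k => if k < 0 then 1 else v 0
  | n + 1, k =>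
    if k < 0 then 1
    else v k.toNat * pSeq v n (k - 1) +
      ∑ j ∈ Finset.Ico k.toNat (n + 1), (v (j + 1) - v j) * pSeq v n (j : ℤ)

section Cylinder

variable {S : Type} [Nonempty S] [MeasurableSpace S]

/-- Extend a configuration on `Λ` to all of `ℤ`, arbitrarily. -/
def extendConf (Λ : Set ℤ) (ξ : Λ → S) : Conf S := by
  classical
  exact fun i => if h : i ∈ Λ then ξ ⟨i, h⟩ else Classical.arbitrary S

omit [MeasurableSpace S] in
lemma DependsOn_eq_extend {Λ : Set ℤ} {g : Conf S → ℝ} (hg : DependsOn g Λ) :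
    g = fun x => g (extendConf Λ (fun i => x i)) :=
  funext fun x => hg fun i hi => by simp [extendConf, hi]

lemma dependsOn_of_measurable_cylSA {Λ : Set ℤ} {g : Conf S → ℝ} (hg : Measurable[cylSA Λ] g) :
    DependsOn g Λ := by
  intro x y h
  obtain ⟨B, -, hB⟩ := hg (measurableSet_singleton (g x))
  have hx : x ∈ g ⁻¹' {g x} := rfl
  rw [← hB] at hx
  have hy : y ∈ g ⁻¹' {g x} := by
    rw [← hB]
    have e : (fun i : Λ => x i) = fun i : Λ => y i := funext fun i => h i i.2
    change (fun i : Λ => y i) ∈ B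
    rw [← e]
    exact hx
  exact hy.symm

lemma measurable_cylSA_of_dependsOn {Λ : Set ℤ} {g : Conf S → ℝ} (hg : DependsOn g Λ)
    (hm : Measurable g) : Measurable[cylSA Λ] g := by
  classical
  rw [DependsOn_eq_extend hg]
  have h1 : Measurable (extendConf Λ : (Λ → S) → Conf S) := by
    refine measurable_pi_lambda _ fun i => ?_
    by_cases hi : i ∈ Λ
    · simpa [extendConf, hi] using measurable_pi_apply (⟨i, hi⟩ : Λ)
    · simp [extendConf, hi]
  have h2 : Measurable[cylSA Λ] (fun (x : Conf S) (i : Λ) => x i) :=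
    comap_measurable _
  exact (hm.comp h1).comp h2

end Cylinder

lemma continuous_of_dependsOn {S : Type} [Finite S] [Nonempty S] [TopologicalSpace S]
    [DiscreteTopology S] {K : Finset ℤ} {g : Conf S → ℝ} (hg : DependsOn g (K : Set ℤ)) :
    Continuous g := by
  rw [DependsOn_eq_extend hg]
  have : Continuous fun ξ : ((K : Set ℤ) : Type) → S => g (extendConf (K : Set ℤ) ξ) :=
    continuous_of_discreteTopology
  exact this.comp (continuous_pi fun i => continuous_apply (i : ℤ))

section Variation

variable {S : Type} [Nonempty S]

lemma abs_le_pnorm {h : Conf S → ℝ} (hb : ∃ C, ∀ x, |h x| ≤ C) (x : Conf S) : |h x| ≤ pnorm h := by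
  obtain ⟨C, hC⟩ := hb
  exact le_ciSup (f := fun x => |h x|) ⟨C, by rintro _ ⟨y, rfl⟩; exact hC y⟩ x

lemma pnorm_nonneg (h : Conf S → ℝ) : 0 ≤ pnorm h := Real.iSup_nonneg fun _ => abs_nonneg _

lemma sub_le_pvar {h : Conf S → ℝ} (hb : ∃ C, ∀ x, |h x| ≤ C) (x y : Conf S) :
    h x - h y ≤ pvar h := by
  obtain ⟨C, hC⟩ := hb
  have h1 : h x ≤ ⨆ x, h x :=
    le_ciSup ⟨C, by rintro _ ⟨z, rfl⟩; exact (abs_le.1 (hC z)).2⟩ x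
  have h2 : ⨅ x, h x ≤ h y :=
    ciInf_le ⟨-C, by rintro _ ⟨z, rfl⟩; exact (abs_le.1 (hC z)).1⟩ y
  rw [pvar]
  linarith

lemma pvar_nonneg {h : Conf S → ℝ} (hb : ∃ C, ∀ x, |h x| ≤ C) : 0 ≤ pvar h := by
  have := sub_le_pvar hb (Classical.arbitrary _) (Classical.arbitrary _)
  simpa using this

lemma pvar_le_pnorm {h : Conf S → ℝ} (hb : ∃ C, ∀ x, |h x| ≤ C) : pvar h ≤ 2 * pnorm h := by
  have h1 : ⨆ x, h x ≤ pnorm h := ciSup_le fun x => (le_abs_self _).trans (abs_le_pnorm hb x)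
  have h2 : -pnorm h ≤ ⨅ x, h x := le_ciInf fun x => (abs_le.1 (abs_le_pnorm hb x)).1
  rw [pvar]
  linarith

lemma shift_surjective (S : Type) (n : ℤ) : Function.Surjective (shift (S := S) n) := fun x =>
  ⟨shift (-n) x, funext fun i => by simp [shift]⟩

end Variation

section Pot

variable {S : Type} [Fintype S] [Nonempty S] [MeasurableSpace S]

/-- Translate of a finite set. -/
def trans (n : ℤ) (K : Finset ℤ) : Finset ℤ := K.image fun i => n + i

lemma mem_trans {n i : ℤ} {K : Finset ℤ} : i ∈ trans n K ↔ i - n ∈ K := by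
  simp only [trans, Finset.mem_image]
  constructor
  · rintro ⟨j, hj, rfl⟩
    simpa using hj
  · exact fun h => ⟨_, h, by ring⟩

lemma trans_trans (m n : ℤ) (K : Finset ℤ) : trans m (trans n K) = trans (m + n) K := by
  ext i
  simp only [mem_trans]
  rw [sub_sub]

lemma trans_zero (K : Finset ℤ) : trans 0 K = K := by
  ext i
  simp [mem_trans]

lemma trans_injective (n : ℤ) : Function.Injective (trans n) := by
  intro K K' h
  have := congrArg (trans (-n)) h
  simpa [trans_trans, trans_zero] using this

variable (P : Potential S)

lemma Phi_trans (n : ℤ) {K : Finset ℤ} (hK : K.Nonempty) (x : Conf S) :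
    P.Φ (trans n K) x = P.Φ K (shift n x) := P.invariant n K hK x

lemma pnorm_trans (n : ℤ) {K : Finset ℤ} (hK : K.Nonempty) :
    pnorm (P.Φ (trans n K)) = pnorm (P.Φ K) := by
  simp only [pnorm, Phi_trans P n hK]
  exact (shift_surjective S n).iSup_comp (g := fun x => |P.Φ K x|)

lemma pvar_trans (n : ℤ) {K : Finset ℤ} (hK : K.Nonempty) :
    pvar (P.Φ (trans n K)) = pvar (P.Φ K) := by
  simp only [pvar, Phi_trans P n hK]
  rw [(shift_surjective S n).iSup_comp (g := P.Φ K), (shift_surjective S n).iInf_comp (g := P.Φ K)]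

lemma Phi_dependsOn {K : Finset ℤ} (hK : K.Nonempty) : DependsOn (P.Φ K) (K : Set ℤ) :=
  dependsOn_of_measurable_cylSA (P.measurable K hK)

lemma Phi_continuous [TopologicalSpace S] [DiscreteTopology S] {K : Finset ℤ} (hK : K.Nonempty) :
    Continuous (P.Φ K) := continuous_of_dependsOn (Phi_dependsOn P hK)

variable {P}

lemma NormSummable.mem (hsum : NormSummable P) (j : ℤ) :
    Summable ({K : Finset ℤ | j ∈ K}.indicator fun K => pnorm (P.Φ K)) := by
  rw [← summable_subtype_iff_indicator]
  have hmem : ∀ K : {K : Finset ℤ | j ∈ K}, (0 : ℤ) ∈ trans (-j) K := fun K => by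
    rw [mem_trans, zero_sub, neg_neg]
    exact K.2
  have h := hsum.comp_injective
    (i := fun K : {K : Finset ℤ | j ∈ K} => (⟨trans (-j) K, hmem K⟩ : {Λ : Finset ℤ // (0 : ℤ) ∈ Λ}))
    (fun K K' h => Subtype.ext (trans_injective (-j) (congrArg Subtype.val h)))
  refine h.congr fun K => ?_
  exact pnorm_trans P (-j) ⟨j, K.2⟩

lemma NormSummable.meet (hsum : NormSummable P) (Λ : Finset ℤ) :
    Summable fun K : {K : Finset ℤ // (K ∩ Λ).Nonempty} => pnorm (P.Φ K) := by
  change Summable ((fun K => pnorm (P.Φ K)) ∘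
    ((↑) : {K : Finset ℤ | (K ∩ Λ).Nonempty} → Finset ℤ))
  rw [summable_subtype_iff_indicator]
  refine Summable.of_nonneg_of_le (fun K => indicator_nonneg (fun _ _ => pnorm_nonneg _) _)
    (fun K => ?_) (summable_sum fun j (_ : j ∈ Λ) => hsum.mem j)
  have hnn : ∀ j, 0 ≤ {K : Finset ℤ | j ∈ K}.indicator (fun K => pnorm (P.Φ K)) K :=
    fun j => indicator_nonneg (fun _ _ => pnorm_nonneg _) _
  rcases em (K ∈ {K : Finset ℤ | (K ∩ Λ).Nonempty}) with hK | hK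
  · obtain ⟨j, hj⟩ := hK
    rw [Finset.mem_inter] at hj
    rw [indicator_of_mem (show K ∈ {K : Finset ℤ | (K ∩ Λ).Nonempty} from
      ⟨j, Finset.mem_inter.2 hj⟩)]
    refine le_trans (le_of_eq ?_) (Finset.single_le_sum (fun i _ => hnn i) hj.2)
    rw [indicator_of_mem (show K ∈ {K : Finset ℤ | j ∈ K} from hj.1)]
  · rw [indicator_of_notMem hK]
    exact Finset.sum_nonneg fun i _ => hnn i

lemma NormSummable.Phi (hsum : NormSummable P) (Λ : Finset ℤ) (x : Conf S) :
    Summable fun K : {K : Finset ℤ // (K ∩ Λ).Nonempty} => P.Φ K x :=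
  (hsum.meet Λ).of_norm_bounded fun K => abs_le_pnorm (P.bounded K) x

lemma HPot_continuous [TopologicalSpace S] [DiscreteTopology S] (hsum : NormSummable P)
    (Λ : Finset ℤ) : Continuous (HPot P Λ) :=
  continuous_tsum (fun K => Phi_continuous P (K.2.mono Finset.inter_subset_left)) (hsum.meet Λ)
    fun K x => abs_le_pnorm (P.bounded K) x

lemma sum_pvar_le_varTail (hsum : NormSummable P) (F : Finset (Finset ℤ)) (n : ℕ)
    (b : Finset ℤ → ℤ) (hinj : Set.InjOn (fun K => trans (-b K) K) F)
    (h0 : ∀ K ∈ F, b K ∈ K) (hn : ∀ K ∈ F, ∃ i ∈ K, b K + n ≤ i) :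
    ∑ K ∈ F, pvar (P.Φ K) ≤ varTail P n := by
  have hs : Summable fun Λ : {Λ : Finset ℤ // (0 : ℤ) ∈ Λ ∧ ∃ i ∈ Λ, (n : ℤ) ≤ i} =>
      pvar (P.Φ Λ) := by
    have h1 := (hsum.mul_left 2).comp_injective
      (i := fun K : {Λ : Finset ℤ // (0 : ℤ) ∈ Λ ∧ ∃ i ∈ Λ, (n : ℤ) ≤ i} =>
        (⟨K, K.2.1⟩ : {Λ : Finset ℤ // (0 : ℤ) ∈ Λ}))
      (fun K K' h => Subtype.ext (by simpa using congrArg Subtype.val h))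
    exact Summable.of_nonneg_of_le (fun K => pvar_nonneg (P.bounded K))
      (fun K => pvar_le_pnorm (P.bounded K)) h1
  have hmem : ∀ K ∈ F.image (fun K => trans (-b K) K),
      (0 : ℤ) ∈ K ∧ ∃ i ∈ K, (n : ℤ) ≤ i := by
    intro K hK
    obtain ⟨K, hKF, rfl⟩ := Finset.mem_image.1 hK
    obtain ⟨i, hi, hni⟩ := hn K hKF
    refine ⟨?_, i - b K, ?_, by linarith⟩
    · rw [mem_trans]; simpa using h0 K hKF
    · rw [mem_trans]; simpa using hi
  have h2 := hs.sum_le_tsum ((F.image (fun K => trans (-b K) K)).subtype _)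
    (fun K _ => pvar_nonneg (P.bounded K))
  rw [Finset.sum_subtype_of_mem (fun K => pvar (P.Φ K)) hmem, Finset.sum_image hinj] at h2
  refine le_trans (le_of_eq (Finset.sum_congr rfl fun K hK => ?_)) h2
  exact (pvar_trans P _ ⟨_, h0 K hK⟩).symm

variable (hsum : NormSummable P) (hP : ∀ n : ℕ, 1 ≤ n → varTail P n ≤ 1 / (2 * (n : ℝ)))
include hsum hP

lemma sum_pvar_le_of_right (F : Finset (Finset ℤ)) {n : ℕ} (hn : 1 ≤ n) (j : ℤ)
    (hF : ∀ K ∈ F, j ∈ K ∧ ∃ i ∈ K, j + n ≤ i) :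
    ∑ K ∈ F, pvar (P.Φ K) ≤ 1 / (2 * (n : ℝ)) :=
  (sum_pvar_le_varTail hsum F n (fun _ => j) (fun _ _ _ _ h => trans_injective _ h)
    (fun K hK => (hF K hK).1) fun K hK => (hF K hK).2).trans (hP n hn)

lemma sum_pvar_le_of_left (F : Finset (Finset ℤ)) {n : ℕ} (hn : 1 ≤ n) (j : ℤ)
    (hF : ∀ K ∈ F, j ∈ K ∧ (∀ i ∈ K, i ≤ j) ∧ ∃ i ∈ K, i + n ≤ j) :
    ∑ K ∈ F, pvar (P.Φ K) ≤ 1 / (2 * (n : ℝ)) := by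
  have hmin : ∀ K ∈ F, ∃ b ∈ K, ∀ i ∈ K, b ≤ i := fun K hK =>
    Finset.exists_min_image K id ⟨j, (hF K hK).1⟩
  choose! b hb hb' using hmin
  refine (sum_pvar_le_varTail hsum F n b ?_ hb fun K hK => ?_).trans (hP n hn)
  · have max_trans : ∀ K ∈ F, ∀ c, j + c ∈ trans c K ∧ ∀ i ∈ trans c K, i ≤ j + c := by
      intro K hK c
      refine ⟨by rw [mem_trans]; simpa using (hF K hK).1, fun i hi => ?_⟩
      have := (hF K hK).2.1 _ (mem_trans.1 hi)
      linarith
    intro K hK K' hK' h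
    simp only at h
    have h1 := max_trans K hK (-b K)
    have h2 := max_trans K' hK' (-b K')
    have h3 : b K = b K' := by
      rw [h] at h1
      have := h1.2 _ h2.1
      have := h2.2 _ h1.1
      linarith
    rw [h3] at h
    exact trans_injective _ h
  · obtain ⟨h1, -, i, hi, hij⟩ := hF K hK
    exact ⟨j, h1, by have := hb' K hK i hi; linarith⟩

omit hP hsum in
lemma sum_pvar_le_of_cover (F : Finset (Finset ℤ)) (J : Finset ℤ) (p : ℤ → Finset ℤ → Prop)
    (c : ℝ) (hcov : ∀ K ∈ F, ∃ j ∈ J, p j K)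
    (hc : ∀ j ∈ J, ∀ F' : Finset (Finset ℤ), (∀ K ∈ F', p j K) → ∑ K ∈ F', pvar (P.Φ K) ≤ c) :
    ∑ K ∈ F, pvar (P.Φ K) ≤ J.card * c := by
  classical
  have h1 : ∑ K ∈ F, pvar (P.Φ K) ≤ ∑ K ∈ F, ∑ j ∈ J, if p j K then pvar (P.Φ K) else 0 := by
    refine Finset.sum_le_sum fun K hK => ?_
    obtain ⟨j, hj, hpj⟩ := hcov K hK
    refine le_trans (le_of_eq ?_) (Finset.single_le_sum (fun i _ => ?_) hj)
    · rw [if_pos hpj]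
    · split_ifs
      · exact pvar_nonneg (P.bounded K)
      · exact le_rfl
  refine h1.trans ?_
  rw [Finset.sum_comm, ← nsmul_eq_mul]
  refine Finset.sum_le_card_nsmul _ _ _ fun j hj => ?_
  rw [← Finset.sum_filter]
  exact hc j hj _ fun K hK => (Finset.mem_filter.1 hK).2

lemma sum_pvar_long_le (F : Finset (Finset ℤ)) {N L : ℕ} (hL : 1 ≤ L)
    (hF : ∀ K ∈ F, (K ∩ Finset.Icc (-(N : ℤ)) N).Nonempty ∧ ∃ a ∈ K, ∃ b ∈ K, a + L ≤ b) :
    ∑ K ∈ F, pvar (P.Φ K) ≤ (2 * (2 * (N : ℝ) + 1) + L) * (1 / (2 * L)) := by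
  classical
  let p : ℤ → Finset ℤ → Prop := fun j K => j ∈ K ∧ ∃ i ∈ K, j + L ≤ i
  let q : ℤ → Finset ℤ → Prop := fun j K => j ∈ K ∧ (∀ i ∈ K, i ≤ j) ∧ ∃ i ∈ K, i + L ≤ j
  let J := Finset.Icc (-(N : ℤ)) N
  let J' := Finset.Ico (-(N : ℤ)) (N + L)
  let F1 := F.filter fun K => ∃ j ∈ J, p j K
  let F2 := F.filter fun K => ¬∃ j ∈ J, p j K
  have b1 := sum_pvar_le_of_cover (P := P) F1 J p (1 / (2 * L))
    (fun K hK => (Finset.mem_filter.1 hK).2)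
    (fun j _ F' hF' => sum_pvar_le_of_right hsum hP F' hL j hF')
  have b2 := sum_pvar_le_of_cover (P := P) F2 J' q (1 / (2 * L))
    (by
      intro K hK
      obtain ⟨hKF, hK⟩ := Finset.mem_filter.1 hK
      obtain ⟨⟨c, hc⟩, a, ha, b, hb, hab⟩ := hF K hKF
      rw [Finset.mem_inter, Finset.mem_Icc] at hc
      obtain ⟨m, hm, hmax⟩ := Finset.exists_max_image K id ⟨a, ha⟩
      simp only [id] at hmax
      have h1 := hmax c hc.1
      have h2 := hmax b hb
      have h3 : m < c + L := by
        by_contra! h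
        exact hK ⟨c, Finset.mem_Icc.2 hc.2, hc.1, m, hm, h⟩
      exact ⟨m, Finset.mem_Ico.2 ⟨by linarith, by linarith⟩, hm, hmax, a, ha, by linarith⟩)
    (fun j _ F' hF' => sum_pvar_le_of_left hsum hP F' hL j hF')
  rw [← Finset.sum_filter_add_sum_filter_not F fun K => ∃ j ∈ J, p j K]
  have c1 : (J.card : ℝ) = 2 * N + 1 := by
    have : (J.card : ℤ) = 2 * N + 1 := by
      simp only [J, Int.card_Icc]
      omega
    exact_mod_cast this
  have c2 : (J'.card : ℝ) = 2 * N + L := by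
    have : (J'.card : ℤ) = 2 * N + L := by
      simp only [J', Int.card_Ico]
      omega
    exact_mod_cast this
  rw [c1] at b1
  rw [c2] at b2
  have hpos : (0 : ℝ) ≤ 1 / (2 * L) := by positivity
  have : (2 * (2 * (N : ℝ) + 1) + L) * (1 / (2 * L)) =
    (2 * N + 1) * (1 / (2 * L)) + (2 * N + L) * (1 / (2 * L)) + 1 / (2 * L) := by ring
  linarith

/-- The sets of diameter less than `L` that meet the window `[-N, N]`. -/
def shortSets (N L : ℕ) : Finset (Finset ℤ) := by
  classical
  exact (Finset.Icc (-((N : ℤ) + L)) (N + L)).powerset.filter fun K =>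
    (K ∩ Finset.Icc (-(N : ℤ)) N).Nonempty ∧ ∀ a ∈ K, ∀ b ∈ K, b < a + L

omit hP hsum in
lemma mem_shortSets {N L : ℕ} {K : Finset ℤ} : K ∈ shortSets N L ↔
    (K ∩ Finset.Icc (-(N : ℤ)) N).Nonempty ∧ ∀ a ∈ K, ∀ b ∈ K, b < a + L := by
  simp only [shortSets, Finset.mem_filter, Finset.mem_powerset, and_iff_right_iff_imp]
  rintro ⟨⟨c, hc⟩, h⟩ a ha
  rw [Finset.mem_inter, Finset.mem_Icc] at hc
  have := h a ha c hc.1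
  have := h c hc.1 a ha
  rw [Finset.mem_Icc]
  constructor <;> linarith [hc.2.1, hc.2.2]

/-- The part of the Hamiltonian of `[-N, N]` coming from sets of diameter less than `L`. -/
def shortH (P : Potential S) (N L : ℕ) (x : Conf S) : ℝ := ∑ K ∈ shortSets N L, P.Φ K x

lemma long_part_le {N L : ℕ} (hL : 1 ≤ L) (x y : Conf S) :
    (HPot P (Finset.Icc (-(N : ℤ)) N) x - shortH P N L x) -
      (HPot P (Finset.Icc (-(N : ℤ)) N) y - shortH P N L y) ≤
    (2 * (2 * (N : ℝ) + 1) + L) * (1 / (2 * L)) := by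
  classical
  set W := Finset.Icc (-(N : ℤ)) N with hW
  let s0 : Finset {K : Finset ℤ // (K ∩ W).Nonempty} := (shortSets N L).subtype _
  have hlim := (((hsum.Phi W x).hasSum).sub ((hsum.Phi W y).hasSum))
  have e1 : ∀ z, shortH P N L z = ∑ K ∈ s0, P.Φ K z := fun z =>
    (Finset.sum_subtype_of_mem (fun K => P.Φ K z) fun K hK => (mem_shortSets.1 hK).1).symm
  have h1 : HPot P W x - HPot P W y ≤ (2 * (2 * (N : ℝ) + 1) + L) * (1 / (2 * L)) +
      (shortH P N L x - shortH P N L y) := by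
    refine le_of_tendsto hlim ?_
    filter_upwards [eventually_ge_atTop s0] with F hF
    rw [← Finset.sum_sdiff hF, Finset.sum_sub_distrib, Finset.sum_sub_distrib, ← e1, ← e1]
    refine add_le_add_left ?_ _
    rw [← Finset.sum_sub_distrib]
    refine (Finset.sum_le_sum fun K _ => sub_le_pvar (P.bounded K.1) x y).trans ?_
    have h2 := sum_pvar_long_le hsum hP ((F \ s0).map (Function.Embedding.subtype _))
      (N := N) (L := L) hL (by
        intro K hK
        obtain ⟨⟨K, hKW⟩, hK', rfl⟩ := Finset.mem_map.1 hK
        refine ⟨hKW, ?_⟩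
        have h3 := (Finset.mem_sdiff.1 hK').2
        simp only [s0, Finset.mem_subtype, mem_shortSets, not_and] at h3
        have h4 := h3 hKW
        push Not at h4
        exact h4)
    rw [Finset.sum_map] at h2
    exact h2
  linarith

end Pot

/-- Increments of the comparison function `cmpFun`. -/
def cmpInc : ℕ → ℝ
  | 0 => 1
  | j + 1 => cmpInc j * (1 - 3 / (4 * ((j : ℝ) + 1)))

/-- The concave comparison function controlling the influence of a boundary layer. -/
def cmpFun (k : ℕ) : ℝ := ∑ j ∈ Finset.range k, cmpInc j

lemma cmpInc_pos (j : ℕ) : 0 < cmpInc j := by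
  induction j with
  | zero => simp [cmpInc]
  | succ j ih =>
    refine mul_pos ih ?_
    have : (0 : ℝ) < 4 * ((j : ℝ) + 1) := by positivity
    rw [sub_pos, div_lt_one this]
    have : (0 : ℝ) ≤ j := by positivity
    linarith

lemma cmpInc_diff (j : ℕ) :
    cmpInc j / (2 * ((j : ℝ) + 1)) = 2 / 3 * (cmpInc j - cmpInc (j + 1)) := by
  have : (0 : ℝ) < (j : ℝ) + 1 := by positivity
  simp only [cmpInc]
  field_simp
  ring

lemma cmpInc_anti : Antitone cmpInc := by
  refine antitone_nat_of_succ_le fun j => ?_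
  have h := cmpInc_diff j
  have : 0 ≤ cmpInc j / (2 * ((j : ℝ) + 1)) := by
    have := cmpInc_pos j
    positivity
  linarith

lemma cmpFun_eq (k : ℕ) : cmpFun k = 4 * k * cmpInc k := by
  induction k with
  | zero => simp [cmpFun]
  | succ k ih =>
    have h1 : cmpFun (k + 1) = cmpFun k + cmpInc k := by simp [cmpFun, Finset.sum_range_succ]
    rw [h1, ih]
    have : (0 : ℝ) < (k : ℝ) + 1 := by positivity
    simp only [cmpInc]
    push_cast
    field_simp
    ring

lemma cmpFun_nonneg (k : ℕ) : 0 ≤ cmpFun k :=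
  Finset.sum_nonneg fun j _ => (cmpInc_pos j).le

lemma cmpFun_pos {k : ℕ} (hk : 0 < k) : 0 < cmpFun k :=
  Finset.sum_pos (fun j _ => cmpInc_pos j) ⟨0, by simpa using hk⟩

lemma cmpFun_double (m : ℕ) : 8 / 7 * cmpFun m ≤ cmpFun (2 * m) := by
  have h1 : cmpFun (2 * m) = cmpFun m + ∑ j ∈ Finset.range m, cmpInc (m + j) := by
    rw [two_mul]
    simp [cmpFun, Finset.sum_range_add]
  have h2 : (m : ℝ) * cmpInc (2 * m) ≤ ∑ j ∈ Finset.range m, cmpInc (m + j) := by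
    have : ∑ _j ∈ Finset.range m, cmpInc (2 * m) ≤ ∑ j ∈ Finset.range m, cmpInc (m + j) :=
      Finset.sum_le_sum fun j hj => cmpInc_anti (by have := Finset.mem_range.1 hj; omega)
    simpa using this
  have h3 := cmpFun_eq (2 * m)
  push_cast at h3
  nlinarith

lemma cmpFun_double_iter (m r : ℕ) : (8 / 7 : ℝ) ^ r * cmpFun m ≤ cmpFun (2 ^ r * m) := by
  induction r with
  | zero => simp
  | succ r ih =>
    have := cmpFun_double (2 ^ r * m)
    rw [pow_succ, pow_succ, mul_comm (2 ^ r) 2, mul_assoc 2]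
    nlinarith

lemma cmpFun_ratio {L : ℕ} (hL : 0 < L) : cmpFun L / cmpFun (4096 * L) ≤ 1 / 4 := by
  have h := cmpFun_double_iter L 12
  norm_num at h
  have h0 := cmpFun_pos hL
  rw [div_le_iff₀ (cmpFun_pos (by omega))]
  nlinarith

section Mass

variable {ι A : Type*} [Fintype ι] [DecidableEq ι] [Fintype A]

lemma sum_mul_sum_swap (s : Set ι) {F F' B C : (ι → A) → ℝ}
    (hF : DependsOn F s) (hF' : DependsOn F' s) (hB : DependsOn B sᶜ) (hC : DependsOn C sᶜ) :
    (∑ ζ, F ζ * B ζ) * (∑ ζ, F' ζ * C ζ) = (∑ ζ, F' ζ * B ζ) * (∑ ζ, F ζ * C ζ) := by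
  classical
  rw [Finset.sum_mul_sum, Finset.sum_mul_sum, ← Finset.sum_product', ← Finset.sum_product']
  refine Finset.sum_bij' (fun p _ => (s.piecewise p.2 p.1, s.piecewise p.1 p.2))
    (fun p _ => (s.piecewise p.2 p.1, s.piecewise p.1 p.2)) (by simp) (by simp) ?_ ?_ ?_
  · rintro ⟨a, b⟩ -
    ext i <;> by_cases hi : i ∈ s <;> simp [hi]
  · rintro ⟨a, b⟩ -
    ext i <;> by_cases hi : i ∈ s <;> simp [hi]
  · rintro ⟨a, b⟩ -
    have e1 : F (s.piecewise a b) = F a := hF fun i hi => by simp [hi]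
    have e2 : F' (s.piecewise b a) = F' b := hF' fun i hi => by simp [hi]
    have e3 : B (s.piecewise b a) = B a := hB fun i hi => by
      simp [Set.piecewise_eq_of_notMem _ _ _ hi]
    have e4 : C (s.piecewise a b) = C b := hC fun i hi => by
      simp [Set.piecewise_eq_of_notMem _ _ _ hi]
    simp only [e1, e2, e3, e4]
    ring

/-- Integration of `G` against the weight `w`. -/
def mass (w G : (ι → A) → ℝ) : ℝ := ∑ ζ, G ζ * w ζ

lemma mass_sub (w G G' : (ι → A) → ℝ) : mass w (fun ζ => G ζ - G' ζ) = mass w G - mass w G' := by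
  simp [mass, sub_mul]

lemma mass_smul (w G : (ι → A) → ℝ) (a : ℝ) : mass w (fun ζ => a * G ζ) = a * mass w G := by
  simp [mass, Finset.mul_sum, mul_assoc]

lemma mass_mono {w G G' : (ι → A) → ℝ} (hw : ∀ ζ, 0 ≤ w ζ) (h : ∀ ζ, G ζ ≤ G' ζ) :
    mass w G ≤ mass w G' :=
  Finset.sum_le_sum fun ζ _ => mul_le_mul_of_nonneg_right (h ζ) (hw ζ)

lemma mass_nonneg {w G : (ι → A) → ℝ} (hw : ∀ ζ, 0 ≤ w ζ) (h : ∀ ζ, 0 ≤ G ζ) : 0 ≤ mass w G :=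
  Finset.sum_nonneg fun ζ _ => mul_nonneg (h ζ) (hw ζ)

lemma abs_mass_sub_le {w f G G' : (ι → A) → ℝ} (hw : ∀ ζ, 0 ≤ w ζ) (hf0 : ∀ ζ, 0 ≤ f ζ)
    (hf1 : ∀ ζ, f ζ ≤ 1) (hG : ∀ ζ, 0 ≤ G ζ) (hG' : ∀ ζ, 0 ≤ G' ζ) (hm : mass w G = mass w G') :
    |mass w (fun ζ => G ζ * f ζ) - mass w (fun ζ => G' ζ * f ζ)| ≤ mass w G := by
  have a1 : 0 ≤ mass w (fun ζ => G ζ * f ζ) := mass_nonneg hw fun ζ => mul_nonneg (hG ζ) (hf0 ζ)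
  have a2 : 0 ≤ mass w (fun ζ => G' ζ * f ζ) := mass_nonneg hw fun ζ => mul_nonneg (hG' ζ) (hf0 ζ)
  have a3 : mass w (fun ζ => G ζ * f ζ) ≤ mass w G :=
    mass_mono hw fun ζ => mul_le_of_le_one_right (hG ζ) (hf1 ζ)
  have a4 : mass w (fun ζ => G' ζ * f ζ) ≤ mass w G' :=
    mass_mono hw fun ζ => mul_le_of_le_one_right (hG' ζ) (hf1 ζ)
  rw [abs_le]
  constructor <;> linarith

lemma dependsOn_sub_smul {ι A : Type*} {s s' : Set ι} {F F' : (ι → A) → ℝ} (a : ℝ) (hF : DependsOn F s)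
    (hF' : DependsOn F' s') (hs : s' ⊆ s) : DependsOn (fun ζ => F ζ - a * F' ζ) s := by
  intro x y h
  simp only
  rw [hF h, hF' fun i hi => h i (hs hi)]

/-- Peeling off layers: if both `K` and `K'` dominate increasing subweights living on growing
sets of coordinates, the difference of the `f`-integrals is controlled layer by layer. -/
lemma abs_mass_sub_le_layers {w f : (ι → A) → ℝ} (s : ℕ → Set ι) (hs : Monotone s) (H : ℕ → ℝ)
    (d : ℕ) : ∀ (k : ℕ) (V : ℕ → ℝ) (K K' : ℕ → (ι → A) → ℝ),
    (∀ m, k ≤ m → m ≤ k + d → ∀ G G' : (ι → A) → ℝ, (∀ ζ, 0 ≤ G ζ) → (∀ ζ, 0 ≤ G' ζ) →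
      DependsOn G (s m) → DependsOn G' (s m) → mass w G = mass w G' →
      |mass w (fun ζ => G ζ * f ζ) - mass w (fun ζ => G' ζ * f ζ)| ≤ H m * mass w G) →
    (∀ m, k ≤ m → V m ≤ V (m + 1)) → 0 ≤ V k →
    (∀ ζ, 0 ≤ K k ζ) → (∀ ζ, 0 ≤ K' k ζ) →
    (∀ m, k ≤ m → ∀ ζ, K m ζ ≤ K (m + 1) ζ) → (∀ m, k ≤ m → ∀ ζ, K' m ζ ≤ K' (m + 1) ζ) →
    (∀ m, k ≤ m → m ≤ k + d → DependsOn (K m) (s m)) →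
    (∀ m, k ≤ m → m ≤ k + d → DependsOn (K' m) (s m)) →
    (∀ m, k ≤ m → m ≤ k + d → V m ≤ mass w (K m)) →
    (∀ m, k ≤ m → m ≤ k + d → V m ≤ mass w (K' m)) →
    mass w (K (k + d)) = V (k + d) → mass w (K' (k + d)) = V (k + d) →
    |mass w (fun ζ => K (k + d) ζ * f ζ) - mass w (fun ζ => K' (k + d) ζ * f ζ)| ≤
      V k * H k + ∑ i ∈ Finset.range d, (V (k + i + 1) - V (k + i)) * H (k + i + 1) := by
  induction d with
  | zero =>
    intro k V K K' hH hV hV0 hK hK' hKm hKm' hD hD' hM hM' hE hE'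
    have := hH k le_rfl le_rfl (K k) (K' k) hK hK' (hD k le_rfl le_rfl) (hD' k le_rfl le_rfl)
      (by simpa using hE.trans hE'.symm)
    simp only [add_zero] at hE ⊢
    rw [hE] at this
    simpa [mul_comm] using this
  | succ d ih =>
    intro k V K K' hH hV hV0 hK hK' hKm hKm' hD hD' hM hM' hE hE'
    set a := V k / mass w (K k) with ha
    set a' := V k / mass w (K' k) with ha'
    have aux : ∀ x : ℝ, V k ≤ x → 0 ≤ V k / x ∧ V k / x ≤ 1 ∧ V k / x * x = V k := by
      intro x hx
      rcases eq_or_lt_of_le (hV0.trans hx) with h0 | h0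
      · have : V k = 0 := le_antisymm (h0 ▸ hx) hV0
        simp [this]
      · exact ⟨div_nonneg hV0 h0.le, (div_le_one h0).2 hx, div_mul_cancel₀ _ h0.ne'⟩
    obtain ⟨a0, a1, a2⟩ := aux _ (hM k le_rfl (by omega))
    obtain ⟨b0, b1, b2⟩ := aux _ (hM' k le_rfl (by omega))
    have mono : ∀ m, k ≤ m → ∀ ζ, K k ζ ≤ K m ζ := by
      intro m hm ζ
      induction m, hm using Nat.le_induction with
      | base => exact le_rfl
      | succ m hm ih => exact ih.trans (hKm m hm ζ)
    have mono' : ∀ m, k ≤ m → ∀ ζ, K' k ζ ≤ K' m ζ := by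
      intro m hm ζ
      induction m, hm using Nat.le_induction with
      | base => exact le_rfl
      | succ m hm ih => exact ih.trans (hKm' m hm ζ)
    have key := ih (k + 1) (fun m => V m - V k) (fun m ζ => K m ζ - a * K k ζ)
      (fun m ζ => K' m ζ - a' * K' k ζ)
      (fun m h1 h2 => hH m (by omega) (by omega))
      (fun m h1 => by have := hV m (by omega); simpa using this)
      (by have := hV k le_rfl; simpa using this)
      (fun ζ => by
        have h1 := mono (k + 1) (by omega) ζ
        have h2 := mul_le_of_le_one_left (hK ζ) a1
        linarith)
      (fun ζ => by
        have h1 := mono' (k + 1) (by omega) ζ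
        have h2 := mul_le_of_le_one_left (hK' ζ) b1
        linarith)
      (fun m h1 ζ => by have := hKm m (by omega) ζ; linarith)
      (fun m h1 ζ => by have := hKm' m (by omega) ζ; linarith)
      (fun m h1 h2 => dependsOn_sub_smul a (hD m (by omega) (by omega)) (hD k le_rfl (by omega))
        (hs (by omega)))
      (fun m h1 h2 => dependsOn_sub_smul a' (hD' m (by omega) (by omega)) (hD' k le_rfl (by omega))
        (hs (by omega)))
      (fun m h1 h2 => by
        rw [mass_sub, mass_smul, a2]
        exact sub_le_sub_right (hM m (by omega) (by omega)) _)
      (fun m h1 h2 => by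
        rw [mass_sub, mass_smul, b2]
        exact sub_le_sub_right (hM' m (by omega) (by omega)) _)
      (by rw [mass_sub, mass_smul, a2, show k + 1 + d = k + (d + 1) by ring, hE])
      (by rw [mass_sub, mass_smul, b2, show k + 1 + d = k + (d + 1) by ring, hE'])
    have first := hH k le_rfl (by omega) (fun ζ => a * K k ζ) (fun ζ => a' * K' k ζ)
      (fun ζ => mul_nonneg a0 (hK ζ)) (fun ζ => mul_nonneg b0 (hK' ζ))
      (fun x y h => by simp only; rw [hD k le_rfl (by omega) h])
      (fun x y h => by simp only; rw [hD' k le_rfl (by omega) h])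
      (by rw [mass_smul, mass_smul, a2, b2])
    rw [mass_smul, a2] at first
    rw [show k + 1 + d = k + (d + 1) by ring] at key
    have e1 : mass w (fun ζ => (K (k + (d + 1)) ζ - a * K k ζ) * f ζ) =
        mass w (fun ζ => K (k + (d + 1)) ζ * f ζ) - mass w (fun ζ => a * K k ζ * f ζ) := by
      simp only [sub_mul, mass_sub]
    have e2 : mass w (fun ζ => (K' (k + (d + 1)) ζ - a' * K' k ζ) * f ζ) =
        mass w (fun ζ => K' (k + (d + 1)) ζ * f ζ) - mass w (fun ζ => a' * K' k ζ * f ζ) := by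
      simp only [sub_mul, mass_sub]
    rw [e1, e2] at key
    rw [Finset.sum_range_succ']
    have e3 : ∑ i ∈ Finset.range d, (V (k + (i + 1) + 1) - V (k + (i + 1))) * H (k + (i + 1) + 1)
        = ∑ i ∈ Finset.range d, (V (k + 1 + i + 1) - V k - (V (k + 1 + i) - V k)) *
          H (k + 1 + i + 1) := by
      refine Finset.sum_congr rfl fun i _ => ?_
      rw [show k + (i + 1) = k + 1 + i by ring]
      ring
    rw [e3]
    simp only [add_zero]
    rw [abs_le] at *
    constructor <;> nlinarith [key.1, key.2, first.1, first.2]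

/-- The minimum of `u` over configurations agreeing with the given one on `s`. -/
def infOn (s : Set ι) (u : (ι → A) → ℝ) (ζ : ι → A) : ℝ :=
  ⨅ ζ' : {ζ' : ι → A // ∀ i ∈ s, ζ' i = ζ i}, u ζ'

lemma infOn_le {s : Set ι} {u : (ι → A) → ℝ} {ζ ζ' : ι → A} (h : ∀ i ∈ s, ζ' i = ζ i) :
    infOn s u ζ ≤ u ζ' :=
  ciInf_le (Set.finite_range _).bddBelow (⟨ζ', h⟩ : {ζ' : ι → A // ∀ i ∈ s, ζ' i = ζ i})

lemma le_infOn {s : Set ι} {u : (ι → A) → ℝ} {ζ : ι → A} {c : ℝ}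
    (h : ∀ ζ' : ι → A, (∀ i ∈ s, ζ' i = ζ i) → c ≤ u ζ') : c ≤ infOn s u ζ := by
  have : Nonempty {ζ' : ι → A // ∀ i ∈ s, ζ' i = ζ i} := ⟨⟨ζ, fun _ _ => rfl⟩⟩
  exact le_ciInf fun ζ' => h ζ' ζ'.2

lemma infOn_mono {s s' : Set ι} (hs : s ⊆ s') (u : (ι → A) → ℝ) (ζ : ι → A) :
    infOn s u ζ ≤ infOn s' u ζ :=
  le_infOn fun _ h => infOn_le fun i hi => h i (hs hi)

lemma dependsOn_infOn (s : Set ι) (u : (ι → A) → ℝ) : DependsOn (infOn s u) s := by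
  intro x y h
  refine le_antisymm (le_infOn fun ζ' h' => infOn_le fun i hi => ?_)
    (le_infOn fun ζ' h' => infOn_le fun i hi => ?_)
  · rw [h' i hi, h i hi]
  · rw [h' i hi, h i hi]

lemma exp_neg_half_inv_bound (x : ℝ) : 1 - Real.exp (-(1 / (2 * (x + 1)))) ≤
    1 / (2 * (x + 1)) := by
  have := Real.add_one_le_exp (-(1 / (2 * (x + 1))))
  linarith

/-- Abel summation of the layer bound against the comparison function. -/
lemma layer_sum_le {n k : ℕ} (hk : 1 ≤ k) (hkn : k < n) {E : ℝ} (v : ℕ → ℝ)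
    (hv : ∀ j : ℕ, 1 - v (j + 1) ≤ 1 / (2 * ((j : ℝ) + 1))) (hvn : v (n + 1) = 1)
    (H : ℕ → ℝ) (hH : ∀ j, H (j + 1) = cmpFun j / cmpFun n + E) :
    v k * H k + ∑ i ∈ Finset.range (n + 1 - k),
      (v (k + i + 1) - v (k + i)) * H (k + i + 1) ≤
      cmpFun k / cmpFun n + (E - 1 / (12 * n)) := by
  have hn0 : 0 < cmpFun n := cmpFun_pos (by omega)
  have hdiff : ∀ j, H (j + 2) - H (j + 1) = cmpInc j / cmpFun n := by
    intro j
    rw [show j + 2 = (j + 1) + 1 from rfl, hH, hH, cmpFun, Finset.sum_range_succ, ← cmpFun]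
    ring
  have gen : ∀ d, v k * H k + ∑ i ∈ Finset.range d, (v (k + i + 1) - v (k + i)) * H (k + i + 1) ≤
      H k - (1 - v (k + d)) * H (k + d) +
        2 / 3 * (cmpInc (k - 1) - cmpInc (k - 1 + d)) / cmpFun n := by
    intro d
    induction d with
    | zero =>
      simp only [Finset.range_zero, Finset.sum_empty, add_zero, sub_self, mul_zero, zero_div]
      linarith
    | succ d ih =>
      rw [Finset.sum_range_succ]
      obtain ⟨k', rfl⟩ : ∃ k', k = k' + 1 := ⟨k - 1, by omega⟩
      have h1 := hdiff (k' + d)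
      have h2 := hv (k' + d)
      have h3 := cmpInc_diff (k' + d)
      have h4 : 0 < cmpInc (k' + d) / cmpFun n := div_pos (cmpInc_pos _) hn0
      simp only [Nat.add_sub_cancel] at ih ⊢
      have e1 : k' + 1 + d = k' + d + 1 := by ring
      have e2 : k' + 1 + (d + 1) = k' + d + 2 := by ring
      have e3 : k' + (d + 1) = k' + d + 1 := by ring
      rw [e1] at ih ⊢
      rw [e2, e3]
      have h5 : (1 - v (k' + d + 1)) * (cmpInc (k' + d) / cmpFun n) ≤
          2 / 3 * (cmpInc (k' + d) - cmpInc (k' + d + 1)) / cmpFun n := by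
        rw [← h3]
        calc _ ≤ 1 / (2 * (((k' + d : ℕ) : ℝ) + 1)) * (cmpInc (k' + d) / cmpFun n) :=
              mul_le_mul_of_nonneg_right h2 h4.le
          _ = _ := by ring
      rw [← h1] at h5
      have h6 : 2 / 3 * (cmpInc k' - cmpInc (k' + d + 1)) / cmpFun n =
        2 / 3 * (cmpInc k' - cmpInc (k' + d)) / cmpFun n +
        2 / 3 * (cmpInc (k' + d) - cmpInc (k' + d + 1)) / cmpFun n := by ring
      rw [h6]
      rw [show k' + d + 1 + 1 = k' + d + 2 from rfl]
      linarith
  refine (gen (n + 1 - k)).trans ?_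
  rw [show k + (n + 1 - k) = n + 1 by omega, show k - 1 + (n + 1 - k) = n by omega, hvn]
  obtain ⟨k', rfl⟩ : ∃ k', k = k' + 1 := ⟨k - 1, by omega⟩
  rw [hH]
  simp only [Nat.add_sub_cancel, sub_self, zero_mul, sub_zero]
  have h1 : cmpFun (k' + 1) = cmpFun k' + cmpInc k' := by simp [cmpFun, Finset.sum_range_succ]
  have h2 : cmpInc n ≤ cmpInc k' := cmpInc_anti (by omega)
  have hn : (0 : ℝ) < n := by
    have : 0 < n := by omega
    exact_mod_cast this
  have h3 : 1 / (12 * (n : ℝ)) = cmpInc n / 3 / cmpFun n := by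
    rw [cmpFun_eq n]
    have := cmpInc_pos n
    field_simp
    norm_num
  rw [h1, h3]
  have h4 : 2 / 3 * (cmpInc k' - cmpInc n) / cmpFun n + cmpInc n / 3 / cmpFun n ≤
      cmpInc k' / cmpFun n := by
    rw [← add_div]
    refine div_le_div_of_nonneg_right ?_ hn0.le
    linarith [cmpInc_pos n]
  rw [add_div]
  linarith

lemma dependsOn_mul {ι A : Type*} {s : Set ι} {F F' : (ι → A) → ℝ} (hF : DependsOn F s)
    (hF' : DependsOn F' s) : DependsOn (fun ζ => F ζ * F' ζ) s := by
  intro x y h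
  simp only
  rw [hF' h, hF h]

/-- Decay of the influence of a boundary layer in a one-sided system of weights. -/
lemma abs_mass_sub_le_cmpFun (idx : ι → ℕ) (u : ℕ → (ι → A) → ℝ) (hu : ∀ t ζ, 0 < u t ζ)
    (hdep : ∀ t, DependsOn (u t) {i | t ≤ idx i})
    (hvar : ∀ (t m : ℕ) (ζ ζ' : ι → A), (∀ i, t ≤ idx i → idx i ≤ t + m → ζ i = ζ' i) →
      u t ζ ≤ Real.exp (1 / (2 * ((m : ℝ) + 1))) * u t ζ')
    {n T : ℕ} (hn : 0 < n) (hT : 12 * n ≤ T) {f : (ι → A) → ℝ} (hf0 : ∀ ζ, 0 ≤ f ζ)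
    (hf1 : ∀ ζ, f ζ ≤ 1) (hf : DependsOn f {i | 12 * n ≤ idx i}) (r : ℕ) :
    ∀ t, 12 * n ≤ t + r → ∀ k, k ≤ n → ∀ G G' : (ι → A) → ℝ,
      (∀ ζ, 0 ≤ G ζ) → (∀ ζ, 0 ≤ G' ζ) → DependsOn G {i | idx i < t + k} →
      DependsOn G' {i | idx i < t + k} →
      mass (fun ζ => ∏ i ∈ Finset.Ico t T, u i ζ) G =
        mass (fun ζ => ∏ i ∈ Finset.Ico t T, u i ζ) G' →
      |mass (fun ζ => ∏ i ∈ Finset.Ico t T, u i ζ) (fun ζ => G ζ * f ζ) -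
        mass (fun ζ => ∏ i ∈ Finset.Ico t T, u i ζ) (fun ζ => G' ζ * f ζ)| ≤
      (cmpFun k / cmpFun n + t / (12 * n)) *
        mass (fun ζ => ∏ i ∈ Finset.Ico t T, u i ζ) G := by
  have hn0 : 0 < cmpFun n := cmpFun_pos hn
  have hnR : (0 : ℝ) < n := by exact_mod_cast hn
  have hw : ∀ t ζ, 0 ≤ ∏ i ∈ Finset.Ico t T, u i ζ :=
    fun t ζ => Finset.prod_nonneg fun i _ => (hu i ζ).le
  have trivial_case : ∀ (t : ℕ) (c : ℝ) (G G' : (ι → A) → ℝ), 1 ≤ c →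
      (∀ ζ, 0 ≤ G ζ) → (∀ ζ, 0 ≤ G' ζ) →
      mass (fun ζ => ∏ i ∈ Finset.Ico t T, u i ζ) G =
        mass (fun ζ => ∏ i ∈ Finset.Ico t T, u i ζ) G' →
      |mass (fun ζ => ∏ i ∈ Finset.Ico t T, u i ζ) (fun ζ => G ζ * f ζ) -
        mass (fun ζ => ∏ i ∈ Finset.Ico t T, u i ζ) (fun ζ => G' ζ * f ζ)| ≤
      c * mass (fun ζ => ∏ i ∈ Finset.Ico t T, u i ζ) G := by
    intro t c G G' hc hG hG' hm
    refine (abs_mass_sub_le (hw t) hf0 hf1 hG hG' hm).trans ?_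
    exact le_mul_of_one_le_left (mass_nonneg (hw t) hG) hc
  have big : ∀ (t k : ℕ), 12 * n ≤ t → (1 : ℝ) ≤ cmpFun k / cmpFun n + t / (12 * n) := by
    intro t k ht
    have h1 : (1 : ℝ) ≤ t / (12 * n) := by
      rw [le_div_iff₀ (by positivity)]
      have : ((12 * n : ℕ) : ℝ) ≤ t := by exact_mod_cast ht
      push_cast at this
      linarith
    have h2 : 0 ≤ cmpFun k / cmpFun n := div_nonneg (cmpFun_nonneg k) hn0.le
    linarith
  induction r with
  | zero =>
    intro t ht k hk G G' hG hG' _ _ hm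
    exact trivial_case t _ G G' (big t k (by omega)) hG hG' hm
  | succ r ih =>
    intro t ht k hk G G' hG hG' hdG hdG' hm
    rcases le_or_gt (12 * n) t with htn | htn
    · exact trivial_case t _ G G' (big t k htn) hG hG' hm
    rcases Nat.eq_zero_or_pos k with rfl | hk0
    · -- no boundary layer left: `f` and the remaining weight do not see `G`
      have hB : DependsOn (fun ζ => ∏ i ∈ Finset.Ico t T, u i ζ) {i | idx i < t}ᶜ := by
        intro x y hxy
        refine Finset.prod_congr rfl fun i hi => hdep i fun j hj => hxy j ?_
        have := (Finset.mem_Ico.1 hi).1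
        simp only [Set.mem_ofPred_eq, Set.mem_compl_iff, not_lt] at hj ⊢
        omega
      have hC : DependsOn (fun ζ => f ζ * ∏ i ∈ Finset.Ico t T, u i ζ) {i | idx i < t}ᶜ := by
        refine dependsOn_mul (fun x y hxy => hf fun j hj => hxy j ?_) hB
        simp only [Set.mem_ofPred_eq, Set.mem_compl_iff, not_lt] at hj ⊢
        omega
      have h := sum_mul_sum_swap {i | idx i < t} hdG hdG' hC hB
      simp only [← mul_assoc] at h
      change mass _ (fun ζ => G ζ * f ζ) * mass _ G' = mass _ (fun ζ => G' ζ * f ζ) * mass _ G at h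
      have h0 := mass_nonneg (hw t) hG
      rw [← hm] at h
      rcases eq_or_lt_of_le h0 with h1 | h1
      · have := abs_mass_sub_le (hw t) hf0 hf1 hG hG' hm
        rw [← h1] at this ⊢
        simpa using this
      · rw [mul_right_cancel₀ h1.ne' h, sub_self, abs_zero]
        exact mul_nonneg (add_nonneg (div_nonneg (cmpFun_nonneg _) hn0.le) (by positivity)) h0
    rcases eq_or_lt_of_le hk with rfl | hkn
    · refine trivial_case t _ G G' ?_ hG hG' hm
      rw [div_self hn0.ne']
      have : (0 : ℝ) ≤ t / (12 * k) := by positivity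
      linarith
    -- peel the weight `u t` into layers
    set Z := mass (fun ζ => ∏ i ∈ Finset.Ico t T, u i ζ) G with hZ
    have hZ0 : 0 ≤ Z := mass_nonneg (hw t) hG
    have split : ∀ F : (ι → A) → ℝ, mass (fun ζ => ∏ i ∈ Finset.Ico t T, u i ζ) F =
        mass (fun ζ => ∏ i ∈ Finset.Ico (t + 1) T, u i ζ) (fun ζ => F ζ * u t ζ) := by
      intro F
      refine Finset.sum_congr rfl fun ζ _ => ?_
      simp only
      rw [Finset.prod_eq_prod_Ico_succ_bot (by omega), mul_assoc]
    let s : ℕ → Set ι := fun m => if m ≤ n then {i | idx i < t + m} else Set.univ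
    have s_le : ∀ m, m ≤ n → s m = {i | idx i < t + m} := fun m h => if_pos h
    have hs : Monotone s := by
      intro a b hab i hi
      rcases le_or_gt b n with hb | hb
      · rw [s_le a (by omega), Set.mem_ofPred_eq] at hi
        rw [s_le b hb, Set.mem_ofPred_eq]
        omega
      · simp [s, not_le.2 hb]
    let U : ℕ → (ι → A) → ℝ := fun m => infOn (s m) (u t)
    let v : ℕ → ℝ := fun m => if m ≤ n then Real.exp (-(1 / (2 * (((m - 1 : ℕ) : ℝ) + 1)))) else 1
    let H : ℕ → ℝ := fun m => cmpFun (m - 1) / cmpFun n + ((t + 1 : ℕ) : ℝ) / (12 * n)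
    have hU_le : ∀ m ζ, U m ζ ≤ u t ζ := fun m ζ => infOn_le fun _ _ => rfl
    have hU0 : ∀ m ζ, 0 ≤ U m ζ := fun m ζ => le_infOn fun ζ' _ => (hu t ζ').le
    have hU_top : ∀ ζ, U (n + 1) ζ = u t ζ := by
      intro ζ
      refine le_antisymm (hU_le _ _) (le_infOn fun ζ' h => ?_)
      rw [show ζ' = ζ from funext fun i => h i (by simp [s])]
    have hUv : ∀ m, k ≤ m → m ≤ n + 1 → ∀ ζ, v m * u t ζ ≤ U m ζ := by
      intro m h1 h2 ζ
      rcases Nat.lt_or_ge n m with h3 | h3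
      · obtain rfl : m = n + 1 := by omega
        rw [hU_top]
        simp [v]
      · refine le_infOn fun ζ' hζ' => ?_
        have := hvar t (m - 1) ζ ζ' fun i hi1 hi2 => (hζ' i (by
          rw [s_le m h3, Set.mem_ofPred_eq]; omega)).symm
        simp only [v, if_pos h3]
        calc _ ≤ Real.exp (-(1 / (2 * (((m - 1 : ℕ) : ℝ) + 1)))) *
              (Real.exp (1 / (2 * (((m - 1 : ℕ) : ℝ) + 1))) * u t ζ') :=
              mul_le_mul_of_nonneg_left this (Real.exp_pos _).le
          _ = u t ζ' := by rw [← mul_assoc, ← Real.exp_add]; simp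
    have hKdep : ∀ F : (ι → A) → ℝ, DependsOn F {i | idx i < t + k} → ∀ m, k ≤ m → m ≤ n + 1 →
        DependsOn (fun ζ => F ζ * U m ζ) (s m) := by
      intro F hF m h1 h2
      refine dependsOn_mul (fun x y hxy => hF fun i hi => hxy i ?_) (dependsOn_infOn _ _)
      rw [← s_le k hk] at hi
      exact hs h1 hi
    have hKmass : ∀ F : (ι → A) → ℝ, (∀ ζ, 0 ≤ F ζ) →
        mass (fun ζ => ∏ i ∈ Finset.Ico t T, u i ζ) F = Z → ∀ m, k ≤ m → m ≤ n + 1 →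
        v m * Z ≤ mass (fun ζ => ∏ i ∈ Finset.Ico (t + 1) T, u i ζ) (fun ζ => F ζ * U m ζ) := by
      intro F hF hFZ m h1 h2
      rw [← hFZ, split, ← mass_smul]
      refine mass_mono (hw _) fun ζ => ?_
      have := mul_le_mul_of_nonneg_left (hUv m h1 h2 ζ) (hF ζ)
      linarith
    have key := abs_mass_sub_le_layers (w := fun ζ => ∏ i ∈ Finset.Ico (t + 1) T, u i ζ) (f := f)
      s hs H (n + 1 - k) k (fun m => v m * Z) (fun m ζ => G ζ * U m ζ) (fun m ζ => G' ζ * U m ζ)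
      (by
        intro m h1 h2 F F' hF hF' hdF hdF' hFF
        rcases Nat.lt_or_ge n m with h3 | h3
        · obtain rfl : m = n + 1 := by omega
          refine trivial_case (t + 1) _ F F' ?_ hF hF' hFF
          simp only [H, Nat.add_sub_cancel, div_self hn0.ne']
          have : (0 : ℝ) ≤ ((t + 1 : ℕ) : ℝ) / (12 * n) := by positivity
          linarith
        · rw [s_le m h3, show t + m = (t + 1) + (m - 1) by omega] at hdF hdF'
          exact ih (t + 1) (by omega) (m - 1) (by omega) F F' hF hF' hdF hdF' hFF)
      (by
        intro m h1
        refine mul_le_mul_of_nonneg_right ?_ hZ0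
        simp only [v]
        split_ifs with h2 h3
        · refine Real.exp_le_exp.2 (neg_le_neg ?_)
          refine one_div_le_one_div_of_le (by positivity) ?_
          have : ((m - 1 : ℕ) : ℝ) ≤ ((m + 1 - 1 : ℕ) : ℝ) := by exact_mod_cast by omega
          linarith
        · refine Real.exp_le_one_iff.2 ?_
          have : (0 : ℝ) ≤ 1 / (2 * (((m - 1 : ℕ) : ℝ) + 1)) := by positivity
          linarith
        · omega
        · exact le_rfl)
      (by
        refine mul_nonneg ?_ hZ0
        simp only [v, if_pos hk]
        exact (Real.exp_pos _).le)
      (fun ζ => mul_nonneg (hG ζ) (hU0 _ ζ)) (fun ζ => mul_nonneg (hG' ζ) (hU0 _ ζ))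
      (fun m _ ζ => mul_le_mul_of_nonneg_left (infOn_mono (hs (Nat.le_succ m)) _ _) (hG ζ))
      (fun m _ ζ => mul_le_mul_of_nonneg_left (infOn_mono (hs (Nat.le_succ m)) _ _) (hG' ζ))
      (fun m h1 h2 => hKdep G hdG m h1 (by omega)) (fun m h1 h2 => hKdep G' hdG' m h1 (by omega))
      (fun m h1 h2 => hKmass G hG rfl m h1 (by omega))
      (fun m h1 h2 => hKmass G' hG' hm.symm m h1 (by omega))
      (by
        rw [show k + (n + 1 - k) = n + 1 by omega]
        simp only [hU_top, ← split]
        simp [v, hZ])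
      (by
        rw [show k + (n + 1 - k) = n + 1 by omega]
        simp only [hU_top, ← split]
        simp [v, ← hm])
    rw [show k + (n + 1 - k) = n + 1 by omega] at key
    simp only [hU_top] at key
    have e1 : ∀ F : (ι → A) → ℝ, mass (fun ζ => ∏ i ∈ Finset.Ico (t + 1) T, u i ζ)
        (fun ζ => F ζ * u t ζ * f ζ) =
        mass (fun ζ => ∏ i ∈ Finset.Ico t T, u i ζ) (fun ζ => F ζ * f ζ) := by
      intro F
      rw [split]
      simp only [mul_right_comm]
    rw [e1, e1] at key
    refine key.trans ?_
    have hsum := layer_sum_le (n := n) (k := k) hk0 hkn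
      (E := ((t + 1 : ℕ) : ℝ) / (12 * n)) v
      (by
        intro j
        simp only [v]
        split_ifs with h1
        · simpa using exp_neg_half_inv_bound (j : ℝ)
        · rw [sub_self]; positivity)
      (by simp [v]) H (by intro j; simp [H])
    have e2 : v k * Z * H k + ∑ i ∈ Finset.range (n + 1 - k),
        (v (k + i + 1) * Z - v (k + i) * Z) * H (k + i + 1) =
        (v k * H k + ∑ i ∈ Finset.range (n + 1 - k),
          (v (k + i + 1) - v (k + i)) * H (k + i + 1)) * Z := by
      rw [add_mul, Finset.sum_mul]
      congr 1
      · ring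
      · exact Finset.sum_congr rfl fun i _ => by ring
    rw [e2]
    refine mul_le_mul_of_nonneg_right (hsum.trans (le_of_eq ?_)) hZ0
    push_cast
    field_simp
    ring

/-- A boundary layer of width `L` is forgotten, up to `1/4`, at distance `12 * 4096 * L`. -/
lemma abs_mass_sub_le_quarter (idx : ι → ℕ) (u : ℕ → (ι → A) → ℝ) (hu : ∀ t ζ, 0 < u t ζ)
    (hdep : ∀ t, DependsOn (u t) {i | t ≤ idx i})
    (hvar : ∀ (t m : ℕ) (ζ ζ' : ι → A), (∀ i, t ≤ idx i → idx i ≤ t + m → ζ i = ζ' i) →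
      u t ζ ≤ Real.exp (1 / (2 * ((m : ℝ) + 1))) * u t ζ')
    {L T : ℕ} (hL : 0 < L) (hT : 49152 * L ≤ T) {f : (ι → A) → ℝ} (hf0 : ∀ ζ, 0 ≤ f ζ)
    (hf1 : ∀ ζ, f ζ ≤ 1) (hf : DependsOn f {i | 49152 * L ≤ idx i}) {G G' : (ι → A) → ℝ}
    (hG : ∀ ζ, 0 ≤ G ζ) (hG' : ∀ ζ, 0 ≤ G' ζ) (hdG : DependsOn G {i | idx i < L})
    (hdG' : DependsOn G' {i | idx i < L})
    (hm : mass (fun ζ => ∏ i ∈ Finset.range T, u i ζ) G = 1)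
    (hm' : mass (fun ζ => ∏ i ∈ Finset.range T, u i ζ) G' = 1) :
    |mass (fun ζ => ∏ i ∈ Finset.range T, u i ζ) (fun ζ => G ζ * f ζ) -
      mass (fun ζ => ∏ i ∈ Finset.range T, u i ζ) (fun ζ => G' ζ * f ζ)| ≤ 1 / 4 := by
  have h := abs_mass_sub_le_cmpFun idx u hu hdep hvar (n := 4096 * L) (T := T) (by omega)
    (by omega) hf0 hf1 (by simpa [← mul_assoc] using hf) (12 * (4096 * L)) 0 (by omega) L (by omega)
    G G' hG hG' (by simpa using hdG) (by simpa using hdG')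
  rw [← Finset.range_eq_Ico, hm, hm'] at h
  refine (h rfl).trans ?_
  simpa using cmpFun_ratio hL

end Mass

section ShortRange

variable {S : Type} [Fintype S] [Nonempty S] [DecidableEq S] [MeasurableSpace S]

/-- The window `[-N, N]`. -/
abbrev win (N : ℕ) : Finset ℤ := Finset.Icc (-(N : ℤ)) N

lemma ov_eq_left {x : Conf S} {Λ : Finset ℤ} {ζ ζ' : Λ → S} {K : Set ℤ}
    (h : ∀ i : Λ, (i : ℤ) ∈ K → ζ i = ζ' i) : ∀ i ∈ K, ov x Λ ζ i = ov x Λ ζ' i := by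
  intro i hi
  simp only [ov]
  split_ifs with hiΛ
  · exact h ⟨i, hiΛ⟩ hi
  · rfl

lemma ov_eq_right {x y : Conf S} {Λ : Finset ℤ} {ζ : Λ → S} {K : Set ℤ}
    (h : ∀ i ∈ K, i ∉ Λ → x i = y i) : ∀ i ∈ K, ov x Λ ζ i = ov y Λ ζ i := by
  intro i hi
  simp only [ov]
  split_ifs with hiΛ
  · rfl
  · exact h i hi hiΛ

/-- The expectation of `g` under the short range Gibbs distribution in the window. -/
def shortMean (P : Potential S) (N L : ℕ) (x : Conf S) (g : (win N → S) → ℝ) : ℝ :=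
  (∑ ζ, g ζ * Real.exp (-shortH P N L (ov x (win N) ζ))) /
    ∑ ζ, Real.exp (-shortH P N L (ov x (win N) ζ))

variable {P : Potential S} (hsum : NormSummable P)
  (hP : ∀ n : ℕ, 1 ≤ n → varTail P n ≤ 1 / (2 * (n : ℝ)))
include hsum hP

/-- Changing the boundary condition on one side of the window. -/
lemma abs_shortMean_sub_le_quarter {N L : ℕ} (hL : 1 ≤ L) (hN : 49153 * L ≤ N) {ε : ℤ}
    (hε : ε = 1 ∨ ε = -1) {x y : Conf S} (hxy : ∀ i, i ∉ win N → 0 ≤ N - ε * i → x i = y i)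
    {g : (win N → S) → ℝ} (hg0 : ∀ ζ, 0 ≤ g ζ) (hg1 : ∀ ζ, g ζ ≤ 1)
    (hg : DependsOn g {i | (i : ℤ) ∈ win L}) :
    |shortMean P N L x g - shortMean P N L y g| ≤ 1 / 4 := by
  classical
  set κ : ℤ → ℤ := fun i => N - ε * i with hκ
  have hκL : ∀ i j : ℤ, i < j + L → j < i + L → κ i < κ j + L := by
    intro i j h1 h2
    rcases hε with rfl | rfl <;> simp only [hκ] <;> linarith
  have hκW : ∀ i : ℤ, i ∈ win N ↔ 0 ≤ κ i ∧ κ i ≤ 2 * N := by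
    intro i
    rw [Finset.mem_Icc]
    rcases hε with rfl | rfl <;> simp only [hκ] <;> constructor <;> rintro ⟨h1, h2⟩ <;>
      constructor <;> linarith
  set idx : win N → ℕ := fun i => (κ i).toNat with hidx
  have hidxκ : ∀ i : win N, (idx i : ℤ) = κ i := fun i => Int.toNat_of_nonneg ((hκW i).1 i.2).1
  set p0 : Finset ℤ → Prop := fun K => ∃ i ∈ K, κ i < 0 with hp0
  set p : ℕ → Finset ℤ → Prop := fun t K => (∃ i ∈ K, κ i = t) ∧ ∀ i ∈ K, (t : ℤ) ≤ κ i with hp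
  set Sh := shortSets N L with hSh
  have hne : ∀ K ∈ Sh, K.Nonempty := fun K hK =>
    (mem_shortSets.1 hK).1.mono Finset.inter_subset_left
  set A : Conf S → (win N → S) → ℝ := fun z ζ => ∑ K ∈ Sh.filter p0, P.Φ K (ov z (win N) ζ) with hA
  set B : Conf S → ℕ → (win N → S) → ℝ :=
    fun z t ζ => ∑ K ∈ Sh.filter (p t), P.Φ K (ov z (win N) ζ) with hB
  have hdecomp : ∀ z ζ, shortH P N L (ov z (win N) ζ) =
      A z ζ + ∑ t ∈ Finset.range (2 * N + 1), B z t ζ := by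
    intro z ζ
    simp only [hA, hB, Finset.sum_filter]
    rw [Finset.sum_comm, ← Finset.sum_add_distrib]
    refine Finset.sum_congr rfl fun K hK => ?_
    by_cases h0 : p0 K
    · rw [if_pos h0, Finset.sum_eq_zero, add_zero]
      intro t _
      rw [if_neg]
      rintro ⟨-, ht⟩
      obtain ⟨i, hi, hi0⟩ := h0
      have := ht i hi
      omega
    · rw [if_neg h0, zero_add]
      simp only [hp0, not_exists, not_and, not_lt] at h0
      obtain ⟨i, hi, himin⟩ := Finset.exists_min_image K κ (hne K hK)
      have hi0 := h0 i hi
      obtain ⟨t, ht⟩ := Int.eq_ofNat_of_zero_le hi0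
      have htK : p t K := ⟨⟨i, hi, ht⟩, fun j hj => ht ▸ himin j hj⟩
      rw [Finset.sum_eq_single_of_mem t, if_pos htK]
      · obtain ⟨c, hc⟩ := (mem_shortSets.1 hK).1
        rw [Finset.mem_inter] at hc
        have h1 := ((hκW c).1 hc.2).2
        have h2 := himin c hc.1
        rw [Finset.mem_range]
        omega
      · intro t' _ htt'
        rw [if_neg]
        rintro ⟨⟨j, hj, hjt⟩, h1⟩
        have h2 := h1 i hi
        have h3 := himin j hj
        omega
  have hBxy : ∀ t, B x t = B y t := by
    intro t
    funext ζ
    refine Finset.sum_congr rfl fun K hK => ?_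
    obtain ⟨hKS, -, ht⟩ := Finset.mem_filter.1 hK
    refine Phi_dependsOn P (hne K hKS) (ov_eq_right fun i hi hiW => hxy i hiW ?_)
    have := ht i hi
    change 0 ≤ κ i
    omega
  let u : ℕ → (win N → S) → ℝ := fun t ζ => Real.exp (-B x t ζ)
  let w : (win N → S) → ℝ := fun ζ => ∏ t ∈ Finset.range (2 * N + 1), u t ζ
  have hdec : ∀ z, (∀ t, B x t = B z t) → ∀ ζ,
      Real.exp (-shortH P N L (ov z (win N) ζ)) = Real.exp (-A z ζ) * w ζ := by
    intro z hz ζ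
    simp only [w, u, hz]
    rw [hdecomp, ← Real.exp_sum, ← Real.exp_add, neg_add, Finset.sum_neg_distrib]
  have hmean : ∀ z, (∀ t, B x t = B z t) → shortMean P N L z g =
      mass w (fun ζ => Real.exp (-A z ζ) / mass w (fun ζ => Real.exp (-A z ζ)) * g ζ) := by
    intro z hz
    have e1 : ∑ ζ, Real.exp (-shortH P N L (ov z (win N) ζ)) =
        mass w (fun ζ => Real.exp (-A z ζ)) := Finset.sum_congr rfl fun ζ _ => hdec z hz ζ
    rw [shortMean, e1, mass, Finset.sum_div]
    refine Finset.sum_congr rfl fun ζ _ => ?_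
    rw [hdec z hz ζ]
    ring
  have hw : ∀ ζ, 0 < w ζ := fun ζ => Finset.prod_pos fun t _ => Real.exp_pos _
  have hmpos : ∀ z, 0 < mass w (fun ζ => Real.exp (-A z ζ)) := fun z =>
    Finset.sum_pos (fun ζ _ => mul_pos (Real.exp_pos _) (hw ζ)) Finset.univ_nonempty
  have hmone : ∀ z, mass w
      (fun ζ => Real.exp (-A z ζ) / mass w (fun ζ => Real.exp (-A z ζ))) = 1 := by
    intro z
    have e : (fun ζ => Real.exp (-A z ζ) / mass w (fun ζ => Real.exp (-A z ζ))) =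
        fun ζ => (mass w (fun ζ => Real.exp (-A z ζ)))⁻¹ * Real.exp (-A z ζ) := by
      funext ζ
      ring
    rw [e, mass_smul, inv_mul_cancel₀ (hmpos z).ne']
  have hAdep : ∀ z, DependsOn (A z) {i | idx i < L} := by
    intro z ζ ζ' h
    refine Finset.sum_congr rfl fun K hK => ?_
    obtain ⟨hKS, j, hj, hj0⟩ := Finset.mem_filter.1 hK
    refine Phi_dependsOn P (hne K hKS) (ov_eq_left fun i hi => h i ?_)
    have h1 := (mem_shortSets.1 hKS).2
    have h2 := hκL i j (h1 j hj i hi) (h1 i hi j hj)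
    have h3 := hidxκ i
    rw [Set.mem_ofPred_eq]
    omega
  rw [hmean x fun _ => rfl, hmean y hBxy]
  refine abs_mass_sub_le_quarter idx u (fun t ζ => Real.exp_pos _) ?_ ?_ hL (T := 2 * N + 1)
    (by omega) hg0 hg1 ?_ (fun ζ => div_nonneg (Real.exp_pos _).le (hmpos x).le)
    (fun ζ => div_nonneg (Real.exp_pos _).le (hmpos y).le) ?_ ?_ (hmone x) (hmone y)
  · intro t ζ ζ' h
    refine congrArg (fun r => Real.exp (-r)) (Finset.sum_congr rfl fun K hK => ?_)
    obtain ⟨hKS, -, ht⟩ := Finset.mem_filter.1 hK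
    refine Phi_dependsOn P (hne K hKS) (ov_eq_left fun i hi => h i ?_)
    have h1 := ht i hi
    have h2 := hidxκ i
    rw [Set.mem_ofPred_eq]
    omega
  · intro t m ζ ζ' h
    simp only [u]
    rw [← Real.exp_add]
    refine Real.exp_le_exp.2 ?_
    let q : Finset ℤ → Prop := fun K => ∃ i ∈ K, (t : ℤ) + (m + 1 : ℕ) ≤ κ i
    have h1 : B x t ζ' - B x t ζ ≤ ∑ K ∈ (Sh.filter (p t)).filter q, pvar (P.Φ K) := by
      simp only [hB]
      rw [← Finset.sum_sub_distrib, Finset.sum_filter q]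
      refine Finset.sum_le_sum fun K hK => ?_
      obtain ⟨hKS, -, ht⟩ := Finset.mem_filter.1 hK
      split_ifs with hq
      · exact sub_le_pvar (P.bounded K) _ _
      · refine sub_nonpos.2 (le_of_eq ?_)
        refine (Phi_dependsOn P (hne K hKS) (ov_eq_left fun i hi => ?_)).symm
        have h2 := ht i hi
        have h3 := hidxκ i
        refine h i (by omega) ?_
        by_contra hcon
        exact hq ⟨i, hi, by push_cast; omega⟩
    have h2 : ∑ K ∈ (Sh.filter (p t)).filter q, pvar (P.Φ K) ≤ 1 / (2 * ((m + 1 : ℕ) : ℝ)) := by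
      rcases hε with rfl | rfl
      · refine sum_pvar_le_of_left hsum hP _ (by omega) (N - t) fun K hK => ?_
        obtain ⟨hK1, i, hi, hiq⟩ := Finset.mem_filter.1 hK
        obtain ⟨-, ⟨j, hj, hjt⟩, ht⟩ := Finset.mem_filter.1 hK1
        simp only [hκ] at hjt hiq ht
        refine ⟨?_, fun i hi => ?_, i, hi, by omega⟩
        · rwa [show (N : ℤ) - t = j by omega]
        · have := ht i hi
          omega
      · refine sum_pvar_le_of_right hsum hP _ (by omega) (t - N) fun K hK => ?_
        obtain ⟨hK1, i, hi, hiq⟩ := Finset.mem_filter.1 hK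
        obtain ⟨-, ⟨j, hj, hjt⟩, ht⟩ := Finset.mem_filter.1 hK1
        simp only [hκ] at hjt hiq ht
        refine ⟨?_, i, hi, by omega⟩
        rwa [show (t : ℤ) - N = j by omega]
    push_cast at h2
    linarith
  · intro ζ ζ' h
    refine hg fun i hi => h i ?_
    have h1 := hidxκ i
    rw [Set.mem_ofPred_eq, Finset.mem_Icc] at hi
    rw [Set.mem_ofPred_eq]
    rcases hε with rfl | rfl <;> simp only [hκ] at h1 <;> omega
  · intro ζ ζ' h
    simp only [hAdep x h]
  · intro ζ ζ' h
    simp only [hAdep y h]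

lemma shortMean_sub_le_half {N L : ℕ} (hL : 1 ≤ L) (hN : 49153 * L ≤ N) (x y : Conf S)
    {g : (win N → S) → ℝ} (hg0 : ∀ ζ, 0 ≤ g ζ) (hg1 : ∀ ζ, g ζ ≤ 1)
    (hg : DependsOn g {i | (i : ℤ) ∈ win L}) :
    shortMean P N L x g - shortMean P N L y g ≤ 1 / 2 := by
  let v : Conf S := fun i => if -(N : ℤ) ≤ i then y i else x i
  have h1 := abs_shortMean_sub_le_quarter hsum hP hL hN (ε := 1) (Or.inl rfl) (x := x) (y := v)
    (fun i hi hi0 => by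
      rw [Finset.mem_Icc] at hi
      have : ¬ -(N : ℤ) ≤ i := by omega
      simp [v, this]) hg0 hg1 hg
  have h2 := abs_shortMean_sub_le_quarter hsum hP hL hN (ε := -1) (Or.inr rfl) (x := v) (y := y)
    (fun i _ hi0 => by
      have : -(N : ℤ) ≤ i := by omega
      simp [v, this]) hg0 hg1 hg
  have h3 := (abs_le.1 h1).2
  have h4 := (abs_le.1 h2).2
  linarith

end ShortRange

section Overwrite

variable {S : Type}

lemma ov_ov (x : Conf S) (Λ : Finset ℤ) (ζ ζ' : Λ → S) : ov (ov x Λ ζ) Λ ζ' = ov x Λ ζ' := by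
  funext i
  simp only [ov]
  split_ifs <;> rfl

lemma ov_restrict_self (x : Conf S) (Λ : Finset ℤ) : ov x Λ (fun i => x i) = x := by
  funext i
  simp [ov]

lemma ov_apply_mem (x : Conf S) {Λ : Finset ℤ} (ζ : Λ → S) (i : Λ) : ov x Λ ζ i = ζ i := by
  simp [ov]

lemma ov_apply_notMem (x : Conf S) {Λ : Finset ℤ} (ζ : Λ → S) {i : ℤ} (hi : i ∉ Λ) :
    ov x Λ ζ i = x i := by
  simp [ov, hi]

lemma continuous_ov [TopologicalSpace S] (Λ : Finset ℤ) (ζ : Λ → S) :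
    Continuous fun x : Conf S => ov x Λ ζ := by
  refine continuous_pi fun i => ?_
  by_cases hi : i ∈ Λ
  · simpa [ov, hi] using continuous_const
  · simpa [ov, hi] using continuous_apply i

end Overwrite

section Kernel

variable {S : Type} [Fintype S] [Nonempty S] [DecidableEq S] [MeasurableSpace S]

/-- The partition function. -/
def partFun (P : Potential S) (Λ : Finset ℤ) (x : Conf S) : ℝ :=
  ∑ ζ : Λ → S, Real.exp (-HPot P Λ (ov x Λ ζ))

/-- The finite volume Gibbs kernel applied to `g`. -/
def gam (P : Potential S) (Λ : Finset ℤ) (g : Conf S → ℝ) (x : Conf S) : ℝ :=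
  ∑ ζ : Λ → S, potPhi P Λ (ov x Λ ζ) * g (ov x Λ ζ)

variable {P : Potential S}

lemma partFun_pos (Λ : Finset ℤ) (x : Conf S) : 0 < partFun P Λ x :=
  Finset.sum_pos (fun _ _ => Real.exp_pos _) Finset.univ_nonempty

lemma partFun_ov (Λ : Finset ℤ) (x : Conf S) (ζ : Λ → S) :
    partFun P Λ (ov x Λ ζ) = partFun P Λ x := by
  simp only [partFun, ov_ov]

lemma potPhi_ov (Λ : Finset ℤ) (x : Conf S) (ζ : Λ → S) :
    potPhi P Λ (ov x Λ ζ) = Real.exp (-HPot P Λ (ov x Λ ζ)) / partFun P Λ x := by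
  simp only [potPhi, partFun, ov_ov]

lemma potPhi_pos (Λ : Finset ℤ) (x : Conf S) : 0 < potPhi P Λ x :=
  div_pos (Real.exp_pos _) (partFun_pos Λ x)

lemma sum_potPhi (Λ : Finset ℤ) (x : Conf S) : ∑ ζ : Λ → S, potPhi P Λ (ov x Λ ζ) = 1 := by
  simp only [potPhi_ov, ← Finset.sum_div]
  exact div_self (partFun_pos Λ x).ne'

lemma gam_eq (Λ : Finset ℤ) (g : Conf S → ℝ) (x : Conf S) :
    gam P Λ g x =
      (∑ ζ : Λ → S, g (ov x Λ ζ) * Real.exp (-HPot P Λ (ov x Λ ζ))) / partFun P Λ x := by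
  simp only [gam, potPhi_ov, Finset.sum_div]
  exact Finset.sum_congr rfl fun ζ _ => by ring

lemma gam_le_of_le {Λ : Finset ℤ} {g g' : Conf S → ℝ} {c : ℝ} (h : ∀ x, g x ≤ g' x + c)
    (x : Conf S) : gam P Λ g x ≤ gam P Λ g' x + c := by
  have h1 : gam P Λ g' x + c = ∑ ζ : Λ → S, potPhi P Λ (ov x Λ ζ) * (g' (ov x Λ ζ) + c) := by
    simp only [mul_add, Finset.sum_add_distrib, ← Finset.sum_mul, sum_potPhi, one_mul, gam]
  rw [h1]
  exact Finset.sum_le_sum fun ζ _ => mul_le_mul_of_nonneg_left (h _) (potPhi_pos Λ _).le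

lemma gam_const (Λ : Finset ℤ) (c : ℝ) (x : Conf S) : gam P Λ (fun _ => c) x = c := by
  simp only [gam, ← Finset.sum_mul, sum_potPhi, one_mul]

/-- The oscillation of `g` is at most `d`. -/
def OscLe (g : Conf S → ℝ) (d : ℝ) : Prop := ∀ x y, g x - g y ≤ d

omit [Fintype S] [Nonempty S] [DecidableEq S] [MeasurableSpace S] in
lemma OscLe.of_approx {g g' : Conf S → ℝ} {d η : ℝ} (h : OscLe g d) (h1 : ∀ x, g x ≤ g' x + η)
    (h2 : ∀ x, g' x ≤ g x + η) : OscLe g' (d + 2 * η) := fun x y => by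
  have := h x y
  have := h1 y
  have := h2 x
  linarith

lemma OscLe.gam {g : Conf S → ℝ} {d : ℝ} (h : OscLe g d) (Λ : Finset ℤ) :
    OscLe (gam P Λ g) d := by
  intro x y
  obtain ⟨ζ, -, hζ⟩ := Finset.exists_min_image (Finset.univ : Finset (Λ → S))
    (fun ζ => g (ov y Λ ζ)) Finset.univ_nonempty
  have h1 : g (ov y Λ ζ) ≤ GibbsFormal.gam P Λ g y := by
    have : g (ov y Λ ζ) = ∑ ζ' : Λ → S, potPhi P Λ (ov y Λ ζ') * g (ov y Λ ζ) := by
      rw [← Finset.sum_mul, sum_potPhi, one_mul]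
    rw [this]
    exact Finset.sum_le_sum fun ζ' h' =>
      mul_le_mul_of_nonneg_left (hζ ζ' h') (potPhi_pos Λ _).le
  have h2 := gam_le_of_le (P := P) (Λ := Λ) (g := g) (g' := fun _ => g (ov y Λ ζ)) (c := d)
    (fun z => by have := h z (ov y Λ ζ); linarith) x
  rw [gam_const] at h2
  linarith

variable (hsum : NormSummable P)
include hsum

lemma HPot_sub_eq {Λ M : Finset ℤ} (hΛ : Λ ⊆ M) {z z' : Conf S} (h : ∀ i, i ∉ Λ → z i = z' i) :
    HPot P M z - HPot P M z' = HPot P Λ z - HPot P Λ z' := by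
  have key : ∀ Q : Finset ℤ, HPot P Q z - HPot P Q z' =
      ∑' K, {K : Finset ℤ | (K ∩ Q).Nonempty}.indicator (fun K => P.Φ K z - P.Φ K z') K := by
    intro Q
    rw [HPot, HPot, ← (hsum.Phi Q z).tsum_sub (hsum.Phi Q z')]
    exact tsum_subtype {K : Finset ℤ | (K ∩ Q).Nonempty} fun K => P.Φ K z - P.Φ K z'
  rw [key, key]
  refine tsum_congr fun K => ?_
  by_cases h1 : (K ∩ Λ).Nonempty
  · have h2 : (K ∩ M).Nonempty := h1.mono (Finset.inter_subset_inter_left hΛ)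
    rw [indicator_of_mem (show K ∈ {K : Finset ℤ | (K ∩ Λ).Nonempty} from h1),
      indicator_of_mem (show K ∈ {K : Finset ℤ | (K ∩ M).Nonempty} from h2)]
  · rw [indicator_of_notMem (show K ∉ {K : Finset ℤ | (K ∩ Λ).Nonempty} from h1)]
    by_cases h2 : (K ∩ M).Nonempty
    · rw [indicator_of_mem (show K ∈ {K : Finset ℤ | (K ∩ M).Nonempty} from h2), sub_eq_zero]
      refine Phi_dependsOn P (h2.mono Finset.inter_subset_left) fun i hi => h i fun hiΛ => ?_
      exact h1 ⟨i, Finset.mem_inter.2 ⟨hi, hiΛ⟩⟩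
    · rw [indicator_of_notMem (show K ∉ {K : Finset ℤ | (K ∩ M).Nonempty} from h2)]

/-- Consistency of the finite volume Gibbs kernels. -/
lemma gam_gam {Λ M : Finset ℤ} (hΛ : Λ ⊆ M) (g : Conf S → ℝ) (x : Conf S) :
    gam P M (gam P Λ g) x = gam P M g x := by
  rw [gam_eq M, gam_eq M]
  congr 1
  set z : (M → S) → Conf S := fun ξ => ov x M ξ with hz
  have hL : ∀ ξ, gam P Λ g (z ξ) * Real.exp (-HPot P M (z ξ)) =
      ∑ ζ : Λ → S, Real.exp (-HPot P M (z ξ)) * Real.exp (-HPot P Λ (ov (z ξ) Λ ζ)) *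
        g (ov (z ξ) Λ ζ) / partFun P Λ (z ξ) := by
    intro ξ
    rw [gam_eq, Finset.sum_div, Finset.sum_mul]
    exact Finset.sum_congr rfl fun ζ _ => by ring
  have hR : ∀ ξ, g (z ξ) * Real.exp (-HPot P M (z ξ)) =
      ∑ ζ : Λ → S, Real.exp (-HPot P M (z ξ)) * Real.exp (-HPot P Λ (ov (z ξ) Λ ζ)) *
        g (z ξ) / partFun P Λ (z ξ) := by
    intro ξ
    rw [← Finset.sum_div, ← Finset.sum_mul, ← Finset.mul_sum]
    change _ = _ * partFun P Λ (z ξ) * _ / partFun P Λ (z ξ)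
    have := (partFun_pos (P := P) Λ (z ξ)).ne'
    field_simp
  simp only [hz] at hL hR
  rw [Finset.sum_congr rfl fun ξ _ => hL ξ, Finset.sum_congr rfl fun ξ _ => hR ξ,
    ← Finset.sum_product', ← Finset.sum_product']
  simp only [← hz]
  let sw : (M → S) × (Λ → S) → (M → S) × (Λ → S) := fun p =>
    (fun i => ov (z p.1) Λ p.2 i, fun i => z p.1 i)
  have hz1 : ∀ p, z (sw p).1 = ov (z p.1) Λ p.2 := by
    intro p
    funext i
    by_cases hi : i ∈ M
    · simp [hz, sw, ov, hi]
    · have : i ∉ Λ := fun h => hi (hΛ h)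
      simp [hz, sw, ov, hi, this]
  have hz2 : ∀ p, ov (z (sw p).1) Λ (sw p).2 = z p.1 := by
    intro p
    rw [hz1, ov_ov]
    exact ov_restrict_self _ _
  have hinv : ∀ p, sw (sw p) = p := by
    intro p
    refine Prod.ext (funext fun i => ?_) (funext fun i => ?_)
    · change ov (z (sw p).1) Λ (sw p).2 i = _
      rw [hz2]
      exact ov_apply_mem _ _ _
    · change z (sw p).1 i = _
      rw [hz1]
      exact ov_apply_mem _ _ _
  refine Finset.sum_bij' (fun p _ => sw p) (fun p _ => sw p) (by simp) (by simp)
    (fun p _ => hinv p) (fun p _ => hinv p) fun p _ => ?_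
  have hH := HPot_sub_eq hsum hΛ (z := z p.1) (z' := ov (z p.1) Λ p.2)
    fun i hi => (ov_apply_notMem _ _ hi).symm
  rw [hz2, hz1, partFun_ov, ← Real.exp_add, ← Real.exp_add]
  congr 3
  linarith

lemma gam_continuous [TopologicalSpace S] [DiscreteTopology S] (Λ : Finset ℤ) {g : Conf S → ℝ}
    (hg : Continuous g) : Continuous (gam P Λ g) := by
  have h1 : ∀ ζ : Λ → S, Continuous fun x => Real.exp (-HPot P Λ (ov x Λ ζ)) := fun ζ =>
    Real.continuous_exp.comp ((HPot_continuous hsum Λ).comp (continuous_ov Λ ζ)).neg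
  have h2 : gam P Λ g = fun x => (∑ ζ : Λ → S, g (ov x Λ ζ) *
    Real.exp (-HPot P Λ (ov x Λ ζ))) / partFun P Λ x := funext (gam_eq Λ g)
  rw [h2]
  refine Continuous.div ?_ (continuous_finsetSum _ fun ζ _ => h1 ζ)
    fun x => (partFun_pos Λ x).ne'
  exact continuous_finsetSum _ fun ζ _ => (hg.comp (continuous_ov Λ ζ)).mul (h1 ζ)

lemma potPhi_continuous [TopologicalSpace S] [DiscreteTopology S] (Λ : Finset ℤ) :
    Continuous (potPhi P Λ) := by
  have h1 : Continuous fun x => Real.exp (-HPot P Λ x) :=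
    Real.continuous_exp.comp (HPot_continuous hsum Λ).neg
  exact h1.div (continuous_finsetSum _ fun ζ _ => h1.comp (continuous_ov Λ ζ))
    fun x => (partFun_pos Λ x).ne'

end Kernel

section Contraction

lemma mul_mean_le_mean {β : Type*} [Fintype β] [Nonempty β] {s l h : β → ℝ} {κ : ℝ}
    (hs : ∀ b, 0 < s b) (hl : ∀ b, 0 < l b) (hκ : ∀ b b', κ * l b' ≤ l b) (hh : ∀ b, 0 ≤ h b) :
    κ * ((∑ b, h b * s b) / ∑ b, s b) ≤ (∑ b, h b * (s b * l b)) / ∑ b, s b * l b := by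
  have h1 : 0 < ∑ b, s b := Finset.sum_pos (fun b _ => hs b) Finset.univ_nonempty
  have h2 : 0 < ∑ b, s b * l b :=
    Finset.sum_pos (fun b _ => mul_pos (hs b) (hl b)) Finset.univ_nonempty
  rw [← mul_div_assoc, div_le_div_iff₀ h1 h2, mul_assoc, Finset.sum_mul_sum,
    Finset.sum_mul_sum, Finset.mul_sum]
  refine Finset.sum_le_sum fun b _ => ?_
  rw [Finset.mul_sum]
  refine Finset.sum_le_sum fun b' _ => ?_
  have := mul_le_mul_of_nonneg_left (hκ b b')
    (mul_nonneg (mul_nonneg (hh b) (hs b).le) (hs b').le)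
  linarith

variable {S : Type} [Fintype S] [Nonempty S] [DecidableEq S] [MeasurableSpace S]
  {P : Potential S}

/-- The contraction constant. -/
def ctr : ℝ := Real.exp (-98308)

lemma ctr_pos : 0 < ctr := Real.exp_pos _

lemma ctr_le_one : ctr ≤ 1 := Real.exp_le_one_iff.2 (by norm_num)

variable (hsum : NormSummable P)
  (hP : ∀ n : ℕ, 1 ≤ n → varTail P n ≤ 1 / (2 * (n : ℝ)))
include hsum hP

lemma ctr_mul_shortMean_le {L : ℕ} (hL : 1 ≤ L) (x : Conf S) {h : Conf S → ℝ}
    (h0 : ∀ z, 0 ≤ h z) :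
    ctr * shortMean P (49153 * L) L x (fun ζ => h (ov x (win (49153 * L)) ζ)) ≤
      gam P (win (49153 * L)) h x := by
  set N := 49153 * L with hN
  have hE : ∀ z, Real.exp (-HPot P (win N) z) =
      Real.exp (-shortH P N L z) * Real.exp (-(HPot P (win N) z - shortH P N L z)) := fun z => by
    rw [← Real.exp_add]
    congr 1
    ring
  rw [gam_eq, partFun, shortMean]
  simp only [hE]
  refine mul_mean_le_mean (fun _ => Real.exp_pos _) (fun _ => Real.exp_pos _) (fun ζ ζ' => ?_)
    fun ζ => h0 _
  rw [ctr, ← Real.exp_add]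
  refine Real.exp_le_exp.2 ?_
  have h1 := long_part_le hsum hP (N := N) hL (ov x (win N) ζ) (ov x (win N) ζ')
  have h2 : (2 * (2 * (N : ℝ) + 1) + L) * (1 / (2 * L)) ≤ 98308 := by
    have hL' : (1 : ℝ) ≤ L := by exact_mod_cast hL
    rw [mul_one_div, div_le_iff₀ (by positivity), hN]
    push_cast
    linarith
  linarith

lemma gam_sub_gam_le {L : ℕ} (hL : 1 ≤ L) {h : Conf S → ℝ} (h0 : ∀ z, 0 ≤ h z)
    (h1 : ∀ z, h z ≤ 1) (hh : DependsOn h (win L : Set ℤ)) (x y : Conf S) :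
    gam P (win (49153 * L)) h x - gam P (win (49153 * L)) h y ≤ 1 - ctr / 2 := by
  set N := 49153 * L with hN
  set g : (win N → S) → ℝ := fun ζ => h (ov y (win N) ζ) with hg
  have hgx : (fun ζ => h (ov x (win N) ζ)) = g := by
    funext ζ
    refine hh (ov_eq_right fun i hi hiN => absurd ?_ hiN)
    rw [Finset.mem_coe, Finset.mem_Icc] at hi
    rw [Finset.mem_Icc]
    omega
  have hy := ctr_mul_shortMean_le hsum hP hL y h0
  have hx := ctr_mul_shortMean_le hsum hP hL x (h := fun z => 1 - h z)
    fun z => sub_nonneg.2 (h1 z)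
  have e1 : gam P (win N) (fun z => 1 - h z) x = 1 - gam P (win N) h x := by
    simp only [gam, mul_sub, mul_one, Finset.sum_sub_distrib, sum_potPhi]
  have e2 : shortMean P N L x (fun ζ => 1 - h (ov x (win N) ζ)) =
      1 - shortMean P N L x g := by
    have : 0 < ∑ ζ, Real.exp (-shortH P N L (ov x (win N) ζ)) :=
      Finset.sum_pos (fun _ _ => Real.exp_pos _) Finset.univ_nonempty
    rw [← hgx, shortMean, shortMean, ← div_self this.ne', ← sub_div, ← Finset.sum_sub_distrib]
    congr 1
    refine Finset.sum_congr rfl fun ζ _ => ?_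
    rw [div_self this.ne']
    ring
  have h3 := shortMean_sub_le_half hsum hP hL (N := N) le_rfl x y (g := g) (fun ζ => h0 _)
    (fun ζ => h1 _) 
    (fun ζ ζ' hζ => hh (ov_eq_left fun i hi => hζ i hi))
  rw [e1, e2] at hx
  have := mul_le_mul_of_nonneg_left h3 ctr_pos.le
  linarith

lemma OscLe.gam_contract {L : ℕ} (hL : 1 ≤ L) {g : Conf S → ℝ} {d : ℝ} (hd : 0 < d)
    (hg : OscLe g d) (hgL : DependsOn g (win L : Set ℤ)) :
    OscLe (GibbsFormal.gam P (win (49153 * L)) g) ((1 - ctr / 2) * d) := by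
  intro x y
  have hb : BddBelow (range g) := ⟨g x - d, by
    rintro _ ⟨z, rfl⟩
    have := hg x z
    linarith⟩
  set m := ⨅ z, g z
  have hm : ∀ z, g z ≤ m + d := fun z => by
    have : g z - d ≤ m := le_ciInf fun w => by
      have := hg z w
      linarith
    linarith
  have key := gam_sub_gam_le hsum hP hL (h := fun z => (g z - m) / d)
    (fun z => div_nonneg (sub_nonneg.2 (ciInf_le hb z)) hd.le)
    (fun z => (div_le_one hd).2 (by linarith [hm z]))
    (fun z w hzw => by simp only [hgL hzw]) x y
  have e : ∀ z, GibbsFormal.gam P (win (49153 * L)) (fun z => (g z - m) / d) z =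
      (GibbsFormal.gam P (win (49153 * L)) g z - m) / d := fun z => by
    simp only [GibbsFormal.gam, mul_div_assoc', mul_sub, ← Finset.sum_div,
      Finset.sum_sub_distrib, ← Finset.sum_mul, sum_potPhi, one_mul]
  rw [e, e, ← sub_div, div_le_iff₀ hd] at key
  linarith

end Contraction

section Oscillation

lemma win_mono {M N : ℕ} (h : M ≤ N) : win M ⊆ win N :=
  Finset.Icc_subset_Icc (by omega) (by omega)

lemma exists_subset_win (I : Finset ℤ) : ∃ N, I ⊆ win N := by
  refine ⟨I.sup Int.natAbs, fun i hi => ?_⟩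
  have := Finset.le_sup (f := Int.natAbs) hi
  rw [Finset.mem_Icc]
  omega

lemma exists_local_approx {S : Type} [Finite S] [Nonempty S] [TopologicalSpace S]
    [DiscreteTopology S] {f : Conf S → ℝ} (hf : Continuous f) {η : ℝ} (hη : 0 < η) :
    ∃ L0, ∀ L, L0 ≤ L → ∃ g : Conf S → ℝ, DependsOn g (win L : Set ℤ) ∧
      (∀ x, f x ≤ g x + η) ∧ ∀ x, g x ≤ f x + η := by
  have hloc : ∀ x : Conf S, ∃ N, ∀ y, (∀ i ∈ win N, y i = x i) → |f y - f x| < η / 2 := by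
    intro x
    have ho : IsOpen {y | |f y - f x| < η / 2} :=
      isOpen_lt (hf.sub continuous_const).abs continuous_const
    obtain ⟨I, u, hu, hsub⟩ := isOpen_pi_iff.1 ho x (by simpa using hη)
    obtain ⟨N, hN⟩ := exists_subset_win I
    refine ⟨N, fun y hy => hsub fun i hi => ?_⟩
    rw [hy i (hN hi)]
    exact (hu i hi).2
  choose N hN using hloc
  obtain ⟨t, -, ht⟩ := isCompact_univ.elim_nhds_subcover
    (fun x : Conf S => (win (N x) : Set ℤ).pi fun i => {x i})
    fun x _ => (isOpen_set_pi (win (N x)).finite_toSet fun i _ => isOpen_discrete _).mem_nhds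
      fun i _ => rfl
  refine ⟨t.sup N, fun L hL => ?_⟩
  let x0 : Conf S := fun _ => Classical.arbitrary S
  have key : ∀ x, |f x - f (merge (win L) x x0)| ≤ η := by
    intro x
    obtain ⟨w, hw, hxw⟩ := mem_iUnion₂.1 (ht (mem_univ x))
    have h1 := hN w x fun i hi => hxw i hi
    have h2 := hN w (merge (win L) x x0) fun i hi => by
      have : i ∈ win L := win_mono ((Finset.le_sup hw).trans hL) hi
      simp only [merge, if_pos this]
      exact hxw i hi
    have := abs_sub_le (f x) (f w) (f (merge (win L) x x0))
    rw [abs_sub_comm] at h2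
    linarith
  refine ⟨fun x => f (merge (win L) x x0), fun x y h => congrArg f (funext fun i => ?_),
    fun x => ?_, fun x => ?_⟩
  · simp only [merge]
    split_ifs with hi
    · exact h i hi
    · rfl
  · linarith [(abs_le.1 (key x)).2]
  · linarith [(abs_le.1 (key x)).1]

variable {S : Type} [Fintype S] [Nonempty S] [DecidableEq S] [TopologicalSpace S]
  [DiscreteTopology S] [MeasurableSpace S] {P : Potential S}

lemma exists_oscLe {f : Conf S → ℝ} (hf : Continuous f) : ∃ d, 0 < d ∧ OscLe f d := by
  obtain ⟨C, hC⟩ := isCompact_univ.exists_bound_of_continuousOn hf.continuousOn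
  have hC' : ∀ x, |f x| ≤ C := fun x => hC x (mem_univ x)
  refine ⟨2 * C + 1, ?_, fun x y => ?_⟩
  · have := (abs_nonneg _).trans (hC' (Classical.arbitrary _))
    linarith
  · have h1 := (abs_le.1 (hC' x)).2
    have h2 := (abs_le.1 (hC' y)).1
    linarith

variable (hsum : NormSummable P)
  (hP : ∀ n : ℕ, 1 ≤ n → varTail P n ≤ 1 / (2 * (n : ℝ)))
include hsum hP

lemma exists_oscLe_step {f : Conf S → ℝ} (hf : Continuous f) {d : ℝ} (hd : 0 < d) {N : ℕ}
    (hN : OscLe (gam P (win N) f) d) :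
    ∃ M, N ≤ M ∧ OscLe (gam P (win M) f) ((1 - ctr / 4) * d) := by
  have hη : 0 < ctr * d / 16 := by have := ctr_pos; positivity
  obtain ⟨L0, hL0⟩ := exists_local_approx (gam_continuous hsum (win N) hf) hη
  obtain ⟨g, hgL, hg1, hg2⟩ := hL0 (max L0 (max 1 N)) (le_max_left _ _)
  have hL : 1 ≤ max L0 (max 1 N) := by omega
  have hNM : N ≤ 49153 * max L0 (max 1 N) := by omega
  set L := max L0 (max 1 N)
  have h1 := hN.of_approx hg1 hg2
  have h2 := h1.gam_contract hsum hP hL (by linarith) hgL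
  have h3 := h2.of_approx (g' := gam P (win (49153 * L)) (gam P (win N) f)) (η := ctr * d / 16)
    (gam_le_of_le hg2) (gam_le_of_le hg1)
  refine ⟨49153 * L, hNM, fun x y => ?_⟩
  have h4 := h3 x y
  rw [gam_gam hsum (win_mono hNM), gam_gam hsum (win_mono hNM)] at h4
  have := ctr_pos
  nlinarith [mul_pos this hd, mul_pos (mul_pos this hd) this]

/-- The finite volume expectations of continuous functions lose their dependence on the boundary
condition as the volume grows. -/
lemma exists_oscLe_gam {f : Conf S → ℝ} (hf : Continuous f) {η : ℝ} (hη : 0 < η) (N1 : ℕ) :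
    ∃ N, N1 ≤ N ∧ OscLe (gam P (win N) f) η := by
  obtain ⟨d, hd, hfd⟩ := exists_oscLe hf
  have h4 : 0 < 1 - ctr / 4 := by linarith [ctr_le_one]
  have iter : ∀ k : ℕ, ∃ N, N1 ≤ N ∧ OscLe (gam P (win N) f) ((1 - ctr / 4) ^ k * d) := by
    intro k
    induction k with
    | zero => exact ⟨N1, le_rfl, by simpa using hfd.gam (win N1)⟩
    | succ k ih =>
      obtain ⟨N, hN, h⟩ := ih
      obtain ⟨M, hM, h'⟩ := exists_oscLe_step hsum hP hf (by positivity) h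
      exact ⟨M, hN.trans hM, by rwa [pow_succ', mul_assoc]⟩
  obtain ⟨k, hk⟩ := exists_pow_lt_of_lt_one (div_pos hη hd) (show 1 - ctr / 4 < 1 by
    linarith [ctr_pos])
  obtain ⟨N, hN, h⟩ := iter k
  exact ⟨N, hN, fun x y => (h x y).trans ((lt_div_iff₀ hd).1 hk).le⟩

end Oscillation

section Measures

variable {S : Type} [Fintype S] [Nonempty S] [DecidableEq S] [TopologicalSpace S]
  [DiscreteTopology S] [MeasurableSpace S] [MeasurableSingletonClass S] {P : Potential S}

/-- Invariance of `μ` under the finite volume Gibbs kernels. -/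
def IsDLR (P : Potential S) (μ : Measure (Conf S)) : Prop :=
  ∀ (Λ : Finset ℤ) (f : Conf S → ℝ), Continuous f → ∫ x, gam P Λ f x ∂μ = ∫ x, f x ∂μ

omit [Nonempty S] [DecidableEq S] in
lemma integrable_of_continuous {f : Conf S → ℝ} (hf : Continuous f) (μ : Measure (Conf S))
    [IsFiniteMeasure μ] : Integrable f μ :=
  hf.integrable_of_hasCompactSupport (HasCompactSupport.of_compactSpace f)

/-- The Gibbs distribution in `Λ` with boundary condition `x`. -/
def finVol (P : Potential S) (Λ : Finset ℤ) (x : Conf S) : Measure (Conf S) :=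
  ∑ ζ : Λ → S, ENNReal.ofReal (potPhi P Λ (ov x Λ ζ)) • Measure.dirac (ov x Λ ζ)

omit [DiscreteTopology S] [TopologicalSpace S] [MeasurableSingletonClass S] in
lemma isProbabilityMeasure_finVol (Λ : Finset ℤ) (x : Conf S) :
    IsProbabilityMeasure (finVol P Λ x) := by
  constructor
  simp only [finVol, Measure.coe_finsetSum, Measure.coe_smul, Finset.sum_apply, Pi.smul_apply,
    measure_univ, smul_eq_mul, mul_one]
  rw [← ENNReal.ofReal_sum_of_nonneg fun ζ _ => (potPhi_pos Λ _).le, sum_potPhi,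
    ENNReal.ofReal_one]

omit [DiscreteTopology S] [TopologicalSpace S] in
lemma integral_finVol (Λ : Finset ℤ) (x : Conf S) (f : Conf S → ℝ) :
    ∫ z, f z ∂finVol P Λ x = gam P Λ f x := by
  rw [finVol, integral_finsetSum_measure fun ζ _ =>
    (integrable_dirac (by simp)).smul_measure ENNReal.ofReal_ne_top]
  refine Finset.sum_congr rfl fun ζ _ => ?_
  rw [integral_smul_measure, integral_dirac, ENNReal.toReal_ofReal (potPhi_pos Λ _).le,
    smul_eq_mul]

omit [MeasurableSpace S] [MeasurableSingletonClass S] [Fintype S] [DecidableEq S] [Nonempty S] in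
lemma isClopen_cylEvent (Λ : Finset ℤ) (ζ : Λ → S) : IsClopen (cylEvent Λ ζ) := by
  have : cylEvent Λ ζ = ⋂ i : Λ, (fun y : Conf S => y i) ⁻¹' {ζ i} := by
    ext y
    simp [cylEvent]
  rw [this]
  exact isClopen_iInter_of_finite fun i => (isClopen_discrete _).preimage (continuous_apply _)

lemma cylSA_le (Λ : Set ℤ) : cylSA (S := S) Λ ≤ MeasurableSpace.pi :=
  (measurable_restrict Λ).comap_le

omit [TopologicalSpace S] [DiscreteTopology S] [MeasurableSingletonClass S] in
lemma gam_indicator_mul (Λ : Finset ℤ) (ζ : Λ → S) {F : Conf S → ℝ}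
    (hF : DependsOn F ((Λ : Set ℤ)ᶜ)) (x : Conf S) :
    gam P Λ (fun z => (cylEvent Λ ζ).indicator 1 z * F z) x = potPhi P Λ (ov x Λ ζ) * F x := by
  rw [gam, Finset.sum_eq_single ζ]
  · rw [indicator_of_mem (show ov x Λ ζ ∈ cylEvent Λ ζ from fun i => ov_apply_mem _ _ i), Pi.one_apply, one_mul,
      hF fun i hi => ov_apply_notMem x ζ hi]
  · intro ζ' _ hne
    rw [indicator_of_notMem, zero_mul, mul_zero]
    intro hmem
    exact hne (funext fun i => (ov_apply_mem x ζ' i).symm.trans (hmem i))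
  · simp

variable (hsum : NormSummable P)
include hsum

lemma exists_isDLR : ∃ μ : Measure (Conf S), IsProbabilityMeasure μ ∧ IsDLR P μ := by
  let x0 : Conf S := fun _ => Classical.arbitrary S
  let μs : ℕ → ProbabilityMeasure (Conf S) := fun N =>
    ⟨finVol P (win N) x0, isProbabilityMeasure_finVol _ _⟩
  obtain ⟨μ, -, hμ⟩ := isCompact_univ.ultrafilter_le_nhds ((hyperfilter ℕ).map μs)
    (by simp)
  have hlim := ProbabilityMeasure.tendsto_iff_forall_integral_tendsto.1
    (show Tendsto μs (hyperfilter ℕ) (nhds μ) from hμ)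
  have hlim' : ∀ f : Conf S → ℝ, Continuous f →
      Tendsto (fun N => gam P (win N) f x0) (hyperfilter ℕ) (nhds (∫ x, f x ∂(μ : Measure _))) := by
    intro f hf
    have := hlim (BoundedContinuousFunction.mkOfCompact ⟨f, hf⟩)
    simpa only [BoundedContinuousFunction.mkOfCompact_apply, ContinuousMap.coe_mk, μs,
      ProbabilityMeasure.coe_mk, integral_finVol] using this
  refine ⟨μ, inferInstance, fun Λ f hf => ?_⟩
  refine tendsto_nhds_unique_of_eventuallyEq (hlim' _ (gam_continuous hsum Λ hf)) (hlim' f hf) ?_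
  obtain ⟨N, hN⟩ := exists_subset_win Λ
  refine Filter.Eventually.filter_mono Nat.hyperfilter_le_atTop ?_
  filter_upwards [eventually_ge_atTop N] with M hM
  exact gam_gam hsum (hN.trans (win_mono hM)) f x0

lemma IsDLR.gibbsCond {μ : Measure (Conf S)} [IsProbabilityMeasure μ] (hμ : IsDLR P μ) :
    GibbsCond (potPhi P) μ := by
  intro Λ _ ζ
  set g : Conf S → ℝ := fun x => potPhi P Λ (ov x Λ ζ) with hg
  have hgc : Continuous g := (potPhi_continuous hsum Λ).comp (continuous_ov Λ ζ)
  have hgd : DependsOn g ((Λ : Set ℤ)ᶜ) := fun x y h => by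
    simp only [hg]
    congr 1
    funext i
    by_cases hi : i ∈ Λ
    · simp [ov, hi]
    · simpa [ov, hi] using h i hi
  have hgpos : ∀ x, 0 < g x := fun x => potPhi_pos Λ _
  have hcyl := isClopen_cylEvent Λ ζ
  have hcylm := hcyl.isOpen.measurableSet
  let r : Conf S → (((Λ : Set ℤ)ᶜ : Set ℤ) → S) := fun x => ((Λ : Set ℤ)ᶜ).domRestrict x
  have hr : Measurable r := measurable_restrict _
  have hrc : Continuous r := Pi.continuous_domRestrict _
  have hgfin : ∫⁻ x, ENNReal.ofReal (g x) ∂μ ≠ ⊤ :=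
    (integrable_of_continuous hgc μ).lintegral_lt_top.ne
  have : IsFiniteMeasure (μ.withDensity fun x => ENNReal.ofReal (g x)) :=
    isFiniteMeasure_withDensity hgfin
  have e1 : ∀ f : (((Λ : Set ℤ)ᶜ : Set ℤ) → S) → ℝ, Measurable f →
      ∫ z, f z ∂((μ.restrict (cylEvent Λ ζ)).map r) =
        ∫ x, (cylEvent Λ ζ).indicator 1 x * f (r x) ∂μ := by
    intro f hf
    rw [integral_map hr.aemeasurable hf.aestronglyMeasurable,
      ← integral_indicator hcylm]
    congr 1
    funext x
    by_cases hx : x ∈ cylEvent Λ ζ <;> simp [hx]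
  have e2 : ∀ f : (((Λ : Set ℤ)ᶜ : Set ℤ) → S) → ℝ, Measurable f →
      ∫ z, f z ∂((μ.withDensity fun x => ENNReal.ofReal (g x)).map r) =
        ∫ x, g x * f (r x) ∂μ := by
    intro f hf
    rw [integral_map hr.aemeasurable hf.aestronglyMeasurable,
      integral_withDensity_eq_integral_toReal_smul hgc.measurable.ennreal_ofReal (by simp)]
    simp only [ENNReal.toReal_ofReal (hgpos _).le, smul_eq_mul]
  have hmap : (μ.restrict (cylEvent Λ ζ)).map r =
      (μ.withDensity fun x => ENNReal.ofReal (g x)).map r := by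
    refine ext_of_forall_integral_eq_of_IsFiniteMeasure fun f => ?_
    rw [e1 _ f.continuous.measurable, e2 _ f.continuous.measurable, ← hμ Λ]
    · refine congrArg _ (funext fun x => gam_indicator_mul Λ ζ (F := fun z => f (r z)) ?_ x)
      exact fun x y h => congrArg f (funext fun i => h i i.2)
    · exact (hcyl.continuous_indicator continuous_one).mul (f.continuous.comp hrc)
  refine ae_eq_condExp_of_forall_setIntegral_eq (cylSA_le _) ?_ ?_ ?_ ?_
  · exact (integrable_const _).indicator hcylm
  · exact fun s _ _ => (integrable_of_continuous hgc μ).integrableOn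
  · rintro s ⟨B, hB, rfl⟩ -
    have hBm : Measurable (B.indicator fun _ => (1 : ℝ)) := measurable_const.indicator hB
    have h1 := e1 _ hBm
    rw [hmap, e2 _ hBm] at h1
    change ∫ x in r ⁻¹' B, g x ∂μ = ∫ x in r ⁻¹' B, _ ∂μ
    rw [← integral_indicator (hr hB), ← integral_indicator (hr hB)]
    convert h1 using 2
    · funext x
      by_cases hx : r x ∈ B
      · rw [indicator_of_mem (show x ∈ r ⁻¹' B from hx), indicator_of_mem hx, mul_one]
      · rw [indicator_of_notMem (show x ∉ r ⁻¹' B from hx), indicator_of_notMem hx, mul_zero]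
    · funext x
      by_cases hx : r x ∈ B
      · rw [indicator_of_mem (show x ∈ r ⁻¹' B from hx), indicator_of_mem hx, mul_one]
        rfl
      · rw [indicator_of_notMem (show x ∉ r ⁻¹' B from hx), indicator_of_notMem hx, mul_zero]
  · exact (measurable_cylSA_of_dependsOn hgd hgc.measurable).stronglyMeasurable.aestronglyMeasurable

end Measures

section Uniqueness

variable {S : Type} [Fintype S] [Nonempty S] [DecidableEq S] [TopologicalSpace S]
  [DiscreteTopology S] [MeasurableSpace S] [MeasurableSingletonClass S] {P : Potential S}

variable (hsum : NormSummable P)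
include hsum

lemma integral_gam_of_gibbsCond {μ : Measure (Conf S)} [IsProbabilityMeasure μ]
    (hμ : GibbsCond (potPhi P) μ) {Λ : Finset ℤ} (hΛ : Λ.Nonempty) {f : Conf S → ℝ}
    (hf : DependsOn f (Λ : Set ℤ)) : ∫ x, gam P Λ f x ∂μ = ∫ x, f x ∂μ := by
  let x0 : Conf S := fun _ => Classical.arbitrary S
  have h1 : ∀ x (ζ : Λ → S), f (ov x Λ ζ) = f (ov x0 Λ ζ) := fun x ζ =>
    hf (ov_eq_right fun i hi hi' => absurd hi hi')
  have h2 : ∀ x, f x = ∑ ζ : Λ → S, (cylEvent Λ ζ).indicator (fun _ => (1 : ℝ)) x *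
      f (ov x0 Λ ζ) := by
    intro x
    rw [Finset.sum_eq_single (fun i : Λ => x i)]
    · rw [indicator_of_mem (show x ∈ cylEvent Λ fun i : Λ => x i from fun i => rfl), one_mul,
        ← h1 x, ov_restrict_self]
    · intro ζ _ hne
      rw [indicator_of_notMem, zero_mul]
      exact fun hmem => hne (funext fun i => (hmem i).symm)
    · simp
  have hcyl : ∀ ζ : Λ → S, Integrable ((cylEvent Λ ζ).indicator fun _ => (1 : ℝ)) μ := fun ζ =>
    (integrable_const _).indicator (isClopen_cylEvent Λ ζ).isOpen.measurableSet
  rw [integral_congr_ae (ae_of_all _ h2), integral_finsetSum _ fun ζ _ => (hcyl ζ).mul_const _]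
  simp only [gam, h1]
  rw [integral_finsetSum]
  · refine Finset.sum_congr rfl fun ζ _ => ?_
    rw [integral_mul_const, integral_mul_const, integral_congr_ae (hμ Λ hΛ ζ),
      integral_condExp (cylSA_le _)]
  · exact fun ζ _ => (integrable_of_continuous
      ((potPhi_continuous hsum Λ).comp (continuous_ov Λ ζ)) μ).mul_const _

variable (hP : ∀ n : ℕ, 1 ≤ n → varTail P n ≤ 1 / (2 * (n : ℝ)))
include hP

lemma integral_le_of_gibbsCond {μ ν : Measure (Conf S)} [IsProbabilityMeasure μ]
    [IsProbabilityMeasure ν] (hμ : GibbsCond (potPhi P) μ) (hν : GibbsCond (potPhi P) ν)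
    {f : Conf S → ℝ} (hf : Continuous f) : ∫ x, f x ∂μ ≤ ∫ x, f x ∂ν := by
  refine le_of_forall_pos_le_add fun η hη => ?_
  have hη3 : 0 < η / 3 := by positivity
  obtain ⟨L, hL⟩ := exists_local_approx hf hη3
  obtain ⟨g, hg, hfg, hgf⟩ := hL L le_rfl
  have hgc := continuous_of_dependsOn hg
  obtain ⟨N, hN, hosc⟩ := exists_oscLe_gam hsum hP hgc hη3 L
  have hne : (win N).Nonempty := ⟨0, by simp⟩
  have hgN : DependsOn g (win N : Set ℤ) := fun x y h =>
    hg fun i hi => h i (win_mono hN hi)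
  have hcg := gam_continuous hsum (win N) hgc
  have i1 : ∫ x, f x ∂μ ≤ ∫ x, g x ∂μ + η / 3 := by
    have := integral_mono (integrable_of_continuous hf μ)
      ((integrable_of_continuous hgc μ).add (integrable_const (η / 3))) hfg
    rwa [integral_add' (integrable_of_continuous hgc μ) (integrable_const _),
      integral_const, probReal_univ, one_smul] at this
  have i2 : ∫ x, g x ∂ν ≤ ∫ x, f x ∂ν + η / 3 := by
    have := integral_mono (integrable_of_continuous hgc ν)
      ((integrable_of_continuous hf ν).add (integrable_const (η / 3))) hgf
    rwa [integral_add' (integrable_of_continuous hf ν) (integrable_const _),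
      integral_const, probReal_univ, one_smul] at this
  rw [← integral_gam_of_gibbsCond hsum hμ hne hgN] at i1
  rw [← integral_gam_of_gibbsCond hsum hν hne hgN] at i2
  have i3 : ∀ y, ∫ x, gam P (win N) g x ∂μ ≤ gam P (win N) g y + η / 3 := fun y => by
    have := integral_mono (integrable_of_continuous hcg μ)
      (integrable_const (gam P (win N) g y + η / 3)) (fun x => by
        have := hosc x y
        change gam P (win N) g x ≤ gam P (win N) g y + η / 3
        linarith)
    rwa [integral_const, probReal_univ, one_smul] at this
  have i4 := integral_mono (integrable_const (∫ x, gam P (win N) g x ∂μ))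
    ((integrable_of_continuous hcg ν).add (integrable_const (η / 3))) i3
  rw [integral_add' (integrable_of_continuous hcg ν) (integrable_const _), integral_const,
    integral_const, probReal_univ, one_smul, one_smul] at i4
  linarith

lemma eq_of_gibbsCond {μ ν : Measure (Conf S)} [IsProbabilityMeasure μ]
    [IsProbabilityMeasure ν] (hμ : GibbsCond (potPhi P) μ) (hν : GibbsCond (potPhi P) ν) :
    μ = ν :=
  ext_of_forall_integral_eq_of_IsFiniteMeasure fun f =>
    (integral_le_of_gibbsCond hsum hP hμ hν f.continuous).antisymm
      (integral_le_of_gibbsCond hsum hP hν hμ f.continuous)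

end Uniqueness

section Shift

variable {S : Type}

lemma shift_ov (n : ℤ) (Λ : Finset ℤ) (x : Conf S) (ζ : Λ → S) :
    ov (shift n x) Λ ζ =
      shift n (ov x (trans n Λ) fun i => ζ ⟨i - n, mem_trans.1 i.2⟩) := by
  funext i
  by_cases hi : i ∈ Λ
  · have h : i + n ∈ trans n Λ := mem_trans.2 (by simpa using hi)
    simp [ov, shift, hi, h]
  · have h : i + n ∉ trans n Λ := fun h => hi (by simpa using mem_trans.1 h)
    simp [ov, shift, hi, h]

/-- Translation of local configurations. -/
def confTransEquiv (S : Type) (n : ℤ) (Λ : Finset ℤ) : (Λ → S) ≃ (trans n Λ → S) where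
  toFun ζ i := ζ ⟨i - n, mem_trans.1 i.2⟩
  invFun ξ i := ξ ⟨i + n, mem_trans.2 (by simp)⟩
  left_inv ζ := by simp
  right_inv ξ := by simp

variable [Fintype S] [Nonempty S] [MeasurableSpace S] {P : Potential S}

lemma HPot_shift (n : ℤ) (Λ : Finset ℤ) (x : Conf S) :
    HPot P Λ (shift n x) = HPot P (trans n Λ) x := by
  let e : {K : Finset ℤ // (K ∩ Λ).Nonempty} ≃ {K : Finset ℤ // (K ∩ trans n Λ).Nonempty} :=
    { toFun K := ⟨trans n K, by
        obtain ⟨i, hi⟩ := K.2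
        rw [Finset.mem_inter] at hi
        exact ⟨i + n, by simp [mem_trans, hi]⟩⟩
      invFun K := ⟨trans (-n) K, by
        obtain ⟨i, hi⟩ := K.2
        rw [Finset.mem_inter, mem_trans] at hi
        exact ⟨i - n, by simp [mem_trans, hi]⟩⟩
      left_inv K := Subtype.ext (by simp [trans_trans, trans_zero])
      right_inv K := Subtype.ext (by simp [trans_trans, trans_zero]) }
  rw [HPot, HPot, ← e.tsum_eq]
  exact tsum_congr fun K => (Phi_trans P n (K.2.mono Finset.inter_subset_left) x).symm

variable [DecidableEq S]

lemma gam_shift (n : ℤ) (Λ : Finset ℤ) (f : Conf S → ℝ) (x : Conf S) :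
    gam P Λ f (shift n x) = gam P (trans n Λ) (fun z => f (shift n z)) x := by
  have h : ∀ F : Conf S → ℝ, ∑ ζ : Λ → S, F (ov (shift n x) Λ ζ) =
      ∑ ξ : trans n Λ → S, F (shift n (ov x (trans n Λ) ξ)) := fun F => by
    rw [← (confTransEquiv S n Λ).sum_comp]
    exact Finset.sum_congr rfl fun ζ _ => congrArg F (shift_ov n Λ x ζ)
  rw [gam_eq, gam_eq, partFun, partFun, h fun z => Real.exp (-HPot P Λ z),
    h fun z => f z * Real.exp (-HPot P Λ z)]
  simp only [HPot_shift]

variable [TopologicalSpace S] [DiscreteTopology S] [MeasurableSingletonClass S]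

omit [Fintype S] [Nonempty S] [MeasurableSpace S] [DecidableEq S] [DiscreteTopology S]
  [MeasurableSingletonClass S] in
lemma continuous_shift (n : ℤ) : Continuous (shift (S := S) n) :=
  continuous_pi fun i => continuous_apply (i + n)

lemma IsDLR.map_shift (hsum : NormSummable P) {μ : Measure (Conf S)} (hμ : IsDLR P μ) (n : ℤ) :
    IsDLR P (μ.map (shift n)) := by
  intro Λ f hf
  have hs := (continuous_shift (S := S) n)
  rw [integral_map hs.measurable.aemeasurable
      (gam_continuous hsum Λ hf).measurable.aestronglyMeasurable,
    integral_map hs.measurable.aemeasurable hf.measurable.aestronglyMeasurable]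
  simp only [gam_shift]
  exact hμ _ _ (hf.comp hs)

end Shift

/-- If `∑_{Λ∋0, Λ∩[n,∞)≠∅} var(Φ_Λ) ≤ 1/(2n)` for all `n ≥ 1`, then the potential
has a unique `T`-invariant Gibbs state. -/
theorem unique_invariant_gibbs_of_half_bound
    {S : Type} [Fintype S] [Nonempty S] [DecidableEq S]
    [TopologicalSpace S] [DiscreteTopology S]
    [MeasurableSpace S] [MeasurableSingletonClass S]
    (P : Potential S) (hsum : NormSummable P)
    (h : ∀ n : ℕ, 1 ≤ n → varTail P n ≤ 1 / (2 * (n : ℝ))) :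
    ∃! μ : Measure (Conf S), IsGibbsPot P μ ∧ μ.map (shift 1) = μ := by
  obtain ⟨μ, hμ, hdlr⟩ := exists_isDLR hsum
  have hmap : IsProbabilityMeasure (μ.map (shift 1)) :=
    Measure.isProbabilityMeasure_map (continuous_shift 1).measurable.aemeasurable
  refine ⟨μ, ⟨⟨hμ, hdlr.gibbsCond hsum⟩, ?_⟩, ?_⟩
  · exact eq_of_gibbsCond hsum h ((hdlr.map_shift hsum 1).gibbsCond hsum) (hdlr.gibbsCond hsum)
  · rintro ν ⟨⟨hν, hνg⟩, -⟩
    exact eq_of_gibbsCond hsum h hνg (hdlr.gibbsCond hsum)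
end GibbsFormal
end
end

section
/- Let 𝒱 = {φ_Λ}_{Λ∈𝒞} be a positive specification on X = S^ℤ. Let Λ ∈ 𝒞 with enumeration Λ = {i_0, …, i_n}, set Λ_j = {i_0, …, i_j} for 0 ≤ j ≤ n and Λ_{-1} = ∅. Then for all x, x* ∈ X: φ_Λ(x) / φ_Λ(x*_Λ x_{Λᶜ}) = ∏_{j=0}^n [ φ_{{i_j}}(x*_{Λ_{j-1}} x_{Λ_{j-1}ᶜ}) / φ_{{i_j}}(x*_{Λ_j} x_{Λ_jᶜ}) ], where for disjoint K, Kᶜ the configuration x*_K x_{Kᶜ} agrees with x* on K and with x on Kᶜ. -/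
open MeasureTheory Filter Set Asymptotics

noncomputable section

namespace GibbsFormal

variable {S : Type} [Fintype S] [Nonempty S] [DecidableEq S]
  [TopologicalSpace S] [DiscreteTopology S]
  [MeasurableSpace S] [MeasurableSingletonClass S]

theorem ov_congr {A : Type} {x y : Conf A} {K : Finset ℤ} (h : ∀ i ∉ K, x i = y i)
    (ζ : K → A) : ov x K ζ = ov y K ζ := by
  funext i
  by_cases hi : i ∈ K
  · simp [ov, hi]
  · simp [ov, hi, h i hi]

/-- For configurations agreeing off `K ⊆ Λ`, the ratios of `φ_Λ` and of `φ_K` coincide. -/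
theorem Specification.div_eq_div_of_subset {A : Type} [Fintype A] [MeasurableSpace A]
    (V : Specification A) {K Λ : Finset ℤ} (hK : K ⊆ Λ) {x y : Conf A}
    (h : ∀ i ∉ K, x i = y i) (hx : V.φ Λ x ≠ 0) :
    V.φ Λ x / V.φ Λ y = V.φ K x / V.φ K y := by
  have hcx := V.consistent K Λ hK x
  have hcy := V.consistent K Λ hK y
  simp only [← ov_congr h] at hcy
  rw [hcx] at hx
  rw [hcx, hcy, mul_div_mul_right _ _ (right_ne_zero_of_mul hx)]

theorem merge_image_range_succ {A : Type} (e : ℕ → ℤ) (j : ℕ) (x' x : Conf A) (i : ℤ)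
    (hi : i ∉ ({e j} : Finset ℤ)) :
    merge ((Finset.range j).image e) x' x i = merge ((Finset.range (j + 1)).image e) x' x i := by
  have hi : i ≠ e j := by simpa using hi
  simp [merge, Finset.range_add_one, Finset.image_insert, hi]

/-- Equation (2.4): the telescoping product formula for the ratios of a positive
specification along an enumeration `e 0, …, e n` of `Λ`. -/
theorem spec_ratio_product
    {S : Type} [Fintype S] [Nonempty S] [DecidableEq S]
    [TopologicalSpace S] [DiscreteTopology S]
    [MeasurableSpace S] [MeasurableSingletonClass S]
    (V : Specification S) (hpos : V.Positive)
    (n : ℕ) (e : ℕ → ℤ) (he : ∀ a b : ℕ, a ≤ n → b ≤ n → e a = e b → a = b)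
    (x xs : Conf S) :
    V.φ ((Finset.range (n + 1)).image e) x /
        V.φ ((Finset.range (n + 1)).image e)
          (merge ((Finset.range (n + 1)).image e) xs x) =
      ∏ j ∈ Finset.range (n + 1),
        V.φ {e j} (merge ((Finset.range j).image e) xs x) /
          V.φ {e j} (merge ((Finset.range (j + 1)).image e) xs x) := by
  set Λ := (Finset.range (n + 1)).image e with hΛ
  have hratio : ∀ j ∈ Finset.range (n + 1),
      V.φ {e j} (merge ((Finset.range j).image e) xs x) /
          V.φ {e j} (merge ((Finset.range (j + 1)).image e) xs x) =
        V.φ Λ (merge ((Finset.range j).image e) xs x) /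
          V.φ Λ (merge ((Finset.range (j + 1)).image e) xs x) := fun j hj =>
    (V.div_eq_div_of_subset
      (Finset.singleton_subset_iff.2 (Finset.mem_image_of_mem e hj))
      (merge_image_range_succ e j xs x) (hpos _ _).ne').symm
  have hzero : merge ((Finset.range 0).image e) xs x = x := by
    funext i
    simp [merge]
  have htel : ∀ m : ℕ, ∏ j ∈ Finset.range m,
      V.φ Λ (merge ((Finset.range j).image e) xs x) /
        V.φ Λ (merge ((Finset.range (j + 1)).image e) xs x) =
      V.φ Λ x / V.φ Λ (merge ((Finset.range m).image e) xs x) := by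
    intro m
    induction m with
    | zero => rw [hzero, Finset.prod_range_zero, div_self (hpos _ _).ne']
    | succ m ih => rw [Finset.prod_range_succ, ih, div_mul_div_cancel₀ (hpos _ _).ne']
  rw [Finset.prod_congr rfl hratio, htel]
end GibbsFormal
end
end
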